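/- arXiv:1805.03741 — 5 statements merged into one kernel-verified Lean document; each statement's English description precedes it below -/
import Mathlib

section
/- For all positive integers s_A, t_A, s_C, t_B and Δ there exists a constant c, depending only on s_A, t_A, s_C, t_B and Δ, such that for every integer n ≥ 1, all integer matrices A of size s_A×t_A, B of size s_A×t_B, C of size s_C×t_B and D of size s_C×t_A whose entries all have absolute value at most Δ, and every element g of the Graver basis G(H) of the 4-block n-fold matrix H built from A, B, C, D, one has ‖g‖_∞ ≤ c·n^{s_C}. -/
/-- `x ⊑ y`: `|x i| ≤ |y i|` and `x i · y i ≥ 0` for every coordinate `i`. -/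
def conformal {m : Type*} (x y : m → ℤ) : Prop :=
  ∀ i, |x i| ≤ |y i| ∧ 0 ≤ x i * y i

/-- The Graver basis of an integer matrix `M`: the `⊑`-minimal elements of
`{x : M x = 0, x ≠ 0}`. -/
def graverBasis {R C : Type*} [Fintype C] (M : Matrix R C ℤ) : Set (C → ℤ) :=
  {g | M.mulVec g = 0 ∧ g ≠ 0 ∧
    ∀ z : C → ℤ, M.mulVec z = 0 → z ≠ 0 → conformal z g → z = g}

/-- The 4-block n-fold matrix built from `A, B, C, D`. -/
def fourBlock (n sA tA sC tB : ℕ)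
    (A : Matrix (Fin sA) (Fin tA) ℤ) (B : Matrix (Fin sA) (Fin tB) ℤ)
    (C : Matrix (Fin sC) (Fin tB) ℤ) (D : Matrix (Fin sC) (Fin tA) ℤ) :
    Matrix (Fin sC ⊕ Fin n × Fin sA) (Fin tB ⊕ Fin n × Fin tA) ℤ :=
  Matrix.of fun r c =>
    match r, c with
    | Sum.inl i, Sum.inl j => C i j
    | Sum.inl i, Sum.inr (_, j) => D i j
    | Sum.inr (_, i), Sum.inl j => B i j
    | Sum.inr (k, i), Sum.inr (l, j) => if k = l then A i j else 0

open Filter in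
lemma fb_ultra_nat (g : ℕ → ℕ → ℕ) :
    ∀ᶠ i in (hyperfilter ℕ : Filter ℕ), ∀ᶠ j in (hyperfilter ℕ : Filter ℕ),
      ∀ᶠ k in (hyperfilter ℕ : Filter ℕ), g i j ≤ g j k := by
  by_contra h
  simp only [← Ultrafilter.eventually_not, not_le] at h
  have key : ∀ v i j, g i j = v →
      (∀ᶠ k in (hyperfilter ℕ : Filter ℕ), ∀ᶠ l in (hyperfilter ℕ : Filter ℕ), g k l < g j k) →
      (∀ᶠ k in (hyperfilter ℕ : Filter ℕ), g j k < g i j) → False := by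
    intro v
    induction v using Nat.strong_induction_on with
    | _ v ih =>
      intro i j hv hj hk
      obtain ⟨k, ⟨h1, h2⟩, h3⟩ := ((hk.and hj).and h).exists
      exact ih (g j k) (hv ▸ h1) j k rfl h3 h2
  obtain ⟨i, hi⟩ := h.exists
  obtain ⟨j, hj, hj2⟩ := (hi.and h).exists
  exact key _ i j rfl hj2 hj

lemma fb_conformal_of {m : Type*} {x y : m → ℤ}
    (h : ∀ i, (x i).toNat ≤ (y i).toNat ∧ (-x i).toNat ≤ (-y i).toNat) : conformal x y := by
  intro i
  obtain ⟨h1, h2⟩ := h i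
  generalize x i = a at *
  generalize y i = b at *
  rcases lt_trichotomy a 0 with ha | ha | ha
  · have : b < 0 := by omega
    refine ⟨by rw [abs_of_neg ha, abs_of_neg this]; omega, by nlinarith⟩
  · subst ha; simp
  · have : 0 < b := by omega
    refine ⟨by rw [abs_of_pos ha, abs_of_pos this]; omega, by nlinarith⟩

lemma fb_conformal_trans {m : Type*} {x y z : m → ℤ} (h1 : conformal x y) (h2 : conformal y z) :
    conformal x z := by
  intro i
  obtain ⟨a1, a2⟩ := h1 i
  obtain ⟨b1, b2⟩ := h2 i
  refine ⟨a1.trans b1, ?_⟩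
  generalize x i = a at *
  generalize y i = b at *
  generalize z i = c at *
  rcases lt_trichotomy b 0 with hb | hb | hb
  · have : a ≤ 0 := by nlinarith
    have : c ≤ 0 := by nlinarith
    nlinarith
  · subst hb; simp at a1; simp [a1]
  · have : 0 ≤ a := by nlinarith
    have : 0 ≤ c := by nlinarith
    positivity

open Filter in
lemma fb_ultra {m : Type*} [Finite m] (g : ℕ → ℕ → m → ℤ) :
    ∀ᶠ i in (hyperfilter ℕ : Filter ℕ), ∀ᶠ j in (hyperfilter ℕ : Filter ℕ),
      ∀ᶠ k in (hyperfilter ℕ : Filter ℕ), conformal (g i j) (g j k) := by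
  have h1 : ∀ᶠ i in (hyperfilter ℕ : Filter ℕ), ∀ᶠ j in (hyperfilter ℕ : Filter ℕ),
      ∀ᶠ k in (hyperfilter ℕ : Filter ℕ), ∀ c, (g i j c).toNat ≤ (g j k c).toNat := by
    simp only [eventually_all]
    intro c
    exact fb_ultra_nat fun i j => (g i j c).toNat
  have h2 : ∀ᶠ i in (hyperfilter ℕ : Filter ℕ), ∀ᶠ j in (hyperfilter ℕ : Filter ℕ),
      ∀ᶠ k in (hyperfilter ℕ : Filter ℕ), ∀ c, (-g i j c).toNat ≤ (-g j k c).toNat := by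
    simp only [eventually_all]
    intro c
    exact fb_ultra_nat fun i j => (-g i j c).toNat
  filter_upwards [h1, h2] with i hi1 hi2
  filter_upwards [hi1, hi2] with j hj1 hj2
  filter_upwards [hj1, hj2] with k hk1 hk2
  exact fb_conformal_of fun c => ⟨hk1 c, hk2 c⟩

lemma fb_basis {α : Type*} (r : α → α → Prop) (P : α → Prop)
    (h : ∀ f : ℕ → α, (∀ n, P (f n)) → ∃ i j, i < j ∧ r (f i) (f j)) :
    ∃ F : Finset α, (∀ x ∈ F, P x) ∧ ∀ y, P y → ∃ x ∈ F, r x y := by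
  by_contra hc
  push Not at hc
  obtain ⟨f, hf, hf2⟩ := exists_seq_of_forall_finset_exists P (fun x y => ¬ r x y)
    (fun s hs => hc s hs)
  obtain ⟨i, j, hij, hr⟩ := h f hf
  exact hf2 i j hij hr

open Filter in
lemma fb_gt (i : ℕ) : ∀ᶠ j in (hyperfilter ℕ : Filter ℕ), i < j := by
  have : (hyperfilter ℕ : Filter ℕ) ≤ atTop := by
    rw [← Nat.cofinite_eq_atTop]; exact hyperfilter_le_cofinite
  exact this (eventually_gt_atTop i)

lemma fb_dickson {m : Type*} [Finite m] (P : (m → ℤ) → Prop) :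
    ∃ F : Finset (m → ℤ), (∀ x ∈ F, P x) ∧ ∀ y, P y → ∃ x ∈ F, conformal x y := by
  apply fb_basis
  intro f hf
  obtain ⟨i, hi⟩ := (fb_ultra fun i _ => f i).exists
  obtain ⟨j, hj, hij⟩ := (hi.and (fb_gt i)).exists
  obtain ⟨k, hk⟩ := hj.exists
  exact ⟨i, j, hij, hk⟩

/-- Key wqo statement (Maclagan-type). -/
lemma fb_maclagan {m p : Type*} [Finite m] [Finite p] (Sol : (m → ℤ) → (p → ℤ) → Prop)
    (P : (m → ℤ) → Prop) :
    ∃ F : Finset (m → ℤ), (∀ x ∈ F, P x) ∧ ∀ y, P y → ∃ y' ∈ F, conformal y' y ∧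
      ∀ x, Sol y x → ∃ x', Sol y' x' ∧ conformal x' x := by
  apply fb_basis
  intro f hf
  by_contra hc
  push Not at hc
  have hX : ∀ i j, ∃ x, i < j → conformal (f i) (f j) → Sol (f j) x ∧
      ∀ x', Sol (f i) x' → ¬ conformal x' x := by
    intro i j
    by_cases hij : i < j ∧ conformal (f i) (f j)
    · obtain ⟨x, hx⟩ := hc i j hij.1 hij.2
      exact ⟨x, fun _ _ => hx⟩
    · exact ⟨0, fun h1 h2 => absurd ⟨h1, h2⟩ hij⟩
  choose X hX using hX
  have hf2 := fb_ultra fun i _ => f i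
  obtain ⟨i, hi1, hi2, hi3⟩ := (hf2.and ((fb_ultra X).and hf2)).exists
  obtain ⟨j, ⟨⟨hj1, hj2⟩, hj3⟩, hij⟩ := (((hi1.and hi2).and hf2).and (fb_gt i)).exists
  obtain ⟨k, ⟨⟨hk1, hk2⟩, hk3⟩, hjk⟩ := (((hj1.and hj2).and hj3).and (fb_gt j)).exists
  obtain ⟨l, hl⟩ := hk3.exists
  exact (hX j k hjk hl).2 _ (hX i j hij hk1).1 hk2

lemma fb_finset_bound {m : Type*} [Fintype m] (F : Finset (m → ℤ)) :
    ∃ K : ℕ, ∀ x ∈ F, ∀ i, |x i| ≤ (K : ℤ) := by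
  refine ⟨∑ x ∈ F, ∑ i, (x i).natAbs, fun x hx i => ?_⟩
  rw [Int.abs_eq_natAbs]
  norm_cast
  exact (Finset.single_le_sum (f := fun i => (x i).natAbs) (fun _ _ => Nat.zero_le _)
    (Finset.mem_univ i)).trans
    (Finset.single_le_sum (f := fun x : m → ℤ => ∑ i, (x i).natAbs) (fun _ _ => Nat.zero_le _) hx)

lemma fb_mulVec_inr {n sA tA sC tB : ℕ}
    (A : Matrix (Fin sA) (Fin tA) ℤ) (B : Matrix (Fin sA) (Fin tB) ℤ)
    (C : Matrix (Fin sC) (Fin tB) ℤ) (D : Matrix (Fin sC) (Fin tA) ℤ)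
    (g : Fin tB ⊕ Fin n × Fin tA → ℤ) (k : Fin n) (i : Fin sA) :
    (fourBlock n sA tA sC tB A B C D).mulVec g (Sum.inr (k, i)) =
      B.mulVec (fun j => g (Sum.inl j)) i + A.mulVec (fun j => g (Sum.inr (k, j))) i := by
  simp [fourBlock, Matrix.mulVec, dotProduct, Fintype.sum_sum_type, Fintype.sum_prod_type,
    ite_mul]

lemma fb_mulVec_inl {n sA tA sC tB : ℕ}
    (A : Matrix (Fin sA) (Fin tA) ℤ) (B : Matrix (Fin sA) (Fin tB) ℤ)
    (C : Matrix (Fin sC) (Fin tB) ℤ) (D : Matrix (Fin sC) (Fin tA) ℤ)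
    (g : Fin tB ⊕ Fin n × Fin tA → ℤ) (i : Fin sC) :
    (fourBlock n sA tA sC tB A B C D).mulVec g (Sum.inl i) =
      ∑ j, C i j * g (Sum.inl j) + ∑ k : Fin n, ∑ j, D i j * g (Sum.inr (k, j)) := by
  simp [fourBlock, Matrix.mulVec, dotProduct, Fintype.sum_sum_type, Fintype.sum_prod_type]

lemma fb_twoStage {sA tA tB : ℕ}
    (A : Matrix (Fin sA) (Fin tA) ℤ) (B : Matrix (Fin sA) (Fin tB) ℤ) :
    ∃ K : ℕ, ∀ (n sC : ℕ) (C : Matrix (Fin sC) (Fin tB) ℤ) (D : Matrix (Fin sC) (Fin tA) ℤ)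
      (g : Fin tB ⊕ Fin n × Fin tA → ℤ), g ≠ 0 →
      (∀ r, (fourBlock n sA tA sC tB A B C D).mulVec g (Sum.inr r) = 0) →
      ∃ h : Fin tB ⊕ Fin n × Fin tA → ℤ, h ≠ 0 ∧
        (∀ r, (fourBlock n sA tA sC tB A B C D).mulVec h (Sum.inr r) = 0) ∧
        conformal h g ∧ ∀ c, |h c| ≤ (K : ℤ) := by
  set Sol : (Fin tB → ℤ) → (Fin tA → ℤ) → Prop := fun y x => ∀ i, B.mulVec y i + A.mulVec x i = 0
    with hSol
  obtain ⟨F, hF0, hF⟩ := fb_maclagan Sol (fun y => y ≠ 0)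
  obtain ⟨K1, hK1⟩ := fb_finset_bound F
  obtain ⟨G, hG0, hG⟩ := fb_dickson (fun x => x ≠ 0 ∧ Sol 0 x)
  obtain ⟨K2, hK2⟩ := fb_finset_bound G
  have h3 : ∀ y : Fin tB → ℤ, ∃ K : ℕ, ∀ x, Sol y x → ∃ x', Sol y x' ∧ conformal x' x ∧
      ∀ i, |x' i| ≤ (K : ℤ) := by
    intro y
    obtain ⟨E, hE0, hE⟩ := fb_dickson (Sol y)
    obtain ⟨K, hK⟩ := fb_finset_bound E
    refine ⟨K, fun x hx => ?_⟩
    obtain ⟨x', hx', hc⟩ := hE x hx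
    exact ⟨x', hE0 _ hx', hc, hK _ hx'⟩
  choose K3 hK3 using h3
  refine ⟨K1 + K2 + ∑ y ∈ F, K3 y, ?_⟩
  intro n sC C D g hg hker
  have hker' : ∀ k, Sol (fun j => g (Sum.inl j)) (fun j => g (Sum.inr (k, j))) := by
    intro k i
    rw [← fb_mulVec_inr A B C D g k i]; exact hker _
  by_cases hy : (fun j => g (Sum.inl j)) = 0
  · have hx : ∃ k, (fun j => g (Sum.inr (k, j))) ≠ 0 := by
      by_contra hx
      push Not at hx
      apply hg
      ext c
      rcases c with j | ⟨k, j⟩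
      · exact congrFun hy j
      · exact congrFun (hx k) j
    obtain ⟨k, hk⟩ := hx
    have hs := hker' k
    rw [hy] at hs
    obtain ⟨x', hx', hc⟩ := hG _ ⟨hk, hs⟩
    obtain ⟨hx0, hxs⟩ := hG0 _ hx'
    refine ⟨Sum.elim 0 (fun c => if c.1 = k then x' c.2 else 0), ?_, ?_, ?_, ?_⟩
    · intro h0
      apply hx0
      ext j
      simpa using congrFun h0 (Sum.inr (k, j))
    · rintro ⟨l, i⟩
      rw [fb_mulVec_inr]
      by_cases hl : l = k
      · simp only [Sum.elim_inl, Sum.elim_inr, hl, if_true]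
        exact hxs i
      · simp only [Sum.elim_inl, Sum.elim_inr, hl, if_false]
        have e1 : (fun j : Fin tB => (0 : Fin tB → ℤ) j) = 0 := rfl
        have e2 : (fun j : Fin tA => (0 : ℤ)) = 0 := rfl
        rw [e1, e2, Matrix.mulVec_zero, Matrix.mulVec_zero]; simp
    · rintro (j | ⟨l, j⟩)
      · simp
      · by_cases hl : l = k
        · subst hl; simpa using hc j
        · simp [hl]
    · rintro (j | ⟨l, j⟩)
      · simp; positivity
      · by_cases hl : l = k
        · subst hl
          have := hK2 _ hx' j
          simp
          have : (0:ℤ) ≤ ∑ y ∈ F, (K3 y : ℤ) := by positivity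
          linarith
        · simp [hl]; positivity
  · obtain ⟨y', hy', hyc, hyx⟩ := hF _ hy
    have h4 : ∀ k, ∃ x', Sol y' x' ∧ conformal x' (fun j => g (Sum.inr (k, j))) ∧
        ∀ i, |x' i| ≤ (K3 y' : ℤ) := by
      intro k
      obtain ⟨x1, h1, h2⟩ := hyx _ (hker' k)
      obtain ⟨x2, h5, h6, h7⟩ := hK3 y' x1 h1
      exact ⟨x2, h5, fb_conformal_trans h6 h2, h7⟩
    choose x' hx1 hx2 hx3 using h4
    refine ⟨Sum.elim y' (fun c => x' c.1 c.2), ?_, ?_, ?_, ?_⟩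
    · intro h0
      apply hF0 _ hy'
      ext j
      simpa using congrFun h0 (Sum.inl j)
    · rintro ⟨l, i⟩
      rw [fb_mulVec_inr]
      simpa using hx1 l i
    · rintro (j | ⟨l, j⟩)
      · simpa using hyc j
      · simpa using hx2 l j
    · have hle : (K3 y' : ℤ) ≤ ∑ y ∈ F, (K3 y : ℤ) := by
        exact_mod_cast Finset.single_le_sum (f := K3) (fun _ _ => Nat.zero_le _) hy'
      rintro (j | ⟨l, j⟩)
      · have := hK1 _ hy' j
        simp only [Sum.elim_inl]; push_cast
        have : (0:ℤ) ≤ ∑ y ∈ F, (K3 y : ℤ) := by positivity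
        linarith
      · have := hx3 l j
        simp only [Sum.elim_inr]; push_cast
        linarith

lemma fb_decomp {m : Type*} [Fintype m] (T : AddSubgroup (m → ℤ)) (K : ℤ)
    (hT : ∀ g ∈ T, g ≠ 0 → ∃ h ∈ T, h ≠ 0 ∧ conformal h g ∧ ∀ c, |h c| ≤ K) :
    ∀ (s : ℕ) (g : m → ℤ), g ∈ T → ∑ c, (g c).natAbs ≤ s → ∃ (N : ℕ) (h : Fin N → m → ℤ),
      ∑ j, h j = g ∧ ∀ j, h j ∈ T ∧ h j ≠ 0 ∧ conformal (h j) g ∧ ∀ c, |h j c| ≤ K := by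
  intro s
  induction s with
  | zero =>
    intro g hg hs
    refine ⟨0, Fin.elim0, ?_, fun j => j.elim0⟩
    ext c
    simp at hs
    simp [hs c]
  | succ s ih =>
    intro g hg hs
    by_cases h0 : g = 0
    · exact ⟨0, Fin.elim0, by simp [h0], fun j => j.elim0⟩
    obtain ⟨h, hhT, hh0, hhc, hhK⟩ := hT g hg h0
    have hpt : ∀ c, ((g - h) c).natAbs + (h c).natAbs = (g c).natAbs := by
      intro c
      obtain ⟨h1, h2⟩ := hhc c
      simp only [Pi.sub_apply]
      generalize h c = a at *
      generalize g c = b at *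
      rcases lt_trichotomy b 0 with hb | hb | hb
      · have : a ≤ 0 := by nlinarith
        rw [abs_of_neg hb, abs_of_nonpos this] at h1
        omega
      · subst hb; simp at h1; simp [h1]
      · have : 0 ≤ a := by nlinarith
        rw [abs_of_pos hb, abs_of_nonneg this] at h1
        omega
    have hpos : 0 < ∑ c, (h c).natAbs := by
      obtain ⟨c, hc⟩ := Function.ne_iff.mp hh0
      refine Finset.sum_pos' (fun _ _ => Nat.zero_le _) ⟨c, Finset.mem_univ _, ?_⟩
      simpa [Nat.pos_iff_ne_zero] using hc
    have hsum : ∑ c, ((g - h) c).natAbs + ∑ c, (h c).natAbs = ∑ c, (g c).natAbs := by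
      rw [← Finset.sum_add_distrib]
      exact Finset.sum_congr rfl fun c _ => hpt c
    have hsub : conformal (g - h) g := by
      intro c
      obtain ⟨h1, h2⟩ := hhc c
      have h3 := hpt c
      refine ⟨by rw [Int.abs_eq_natAbs, Int.abs_eq_natAbs]; omega, ?_⟩
      simp only [Pi.sub_apply]
      have h4 : h c * g c ≤ g c * g c := by
        rw [← abs_of_nonneg h2, abs_mul, ← abs_mul_abs_self (g c)]
        gcongr
      linarith
    obtain ⟨N, f, hf, hf2⟩ := ih (g - h) (T.sub_mem hg hhT) (by omega)
    refine ⟨N + 1, Fin.cons h f, by rw [Fin.sum_cons, hf]; abel, ?_⟩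
    intro j
    refine Fin.cases ?_ (fun j => ?_) j
    · exact ⟨hhT, hh0, hhc, hhK⟩
    · obtain ⟨a1, a2, a3, a4⟩ := hf2 j
      exact ⟨a1, a2, fb_conformal_trans a3 hsub, a4⟩

/-- sub-sums of a conformal decomposition are conformal, and nonzero if the index set is nonempty. -/
lemma fb_subsum {m ι : Type*} [Fintype ι] [DecidableEq ι] (h : ι → m → ℤ) (g : m → ℤ)
    (hs : ∑ j, h j = g) (hc : ∀ j, conformal (h j) g) (S : Finset ι) :
    conformal (∑ j ∈ S, h j) g ∧ ((∀ j, h j ≠ 0) → S.Nonempty → ∑ j ∈ S, h j ≠ 0) := by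
  have hcase : ∀ c, (0 ≤ g c ∧ ∀ j, 0 ≤ h j c) ∨ (g c ≤ 0 ∧ ∀ j, h j c ≤ 0) := by
    intro c
    rcases lt_trichotomy (g c) 0 with hb | hb | hb
    · right; exact ⟨hb.le, fun j => by have := (hc j c).2; nlinarith⟩
    · left; refine ⟨hb.ge, fun j => ?_⟩
      have := (hc j c).1
      rw [hb] at this; simp at this; simp [this]
    · left; exact ⟨hb.le, fun j => by have := (hc j c).2; nlinarith⟩
  constructor
  · intro c
    have hg : g c = ∑ j, h j c := by rw [← hs]; simp
    rw [Finset.sum_apply]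
    rcases hcase c with ⟨h1, h2⟩ | ⟨h1, h2⟩
    · have a1 : 0 ≤ ∑ j ∈ S, h j c := Finset.sum_nonneg fun j _ => h2 j
      have a2 : ∑ j ∈ S, h j c ≤ g c := by
        rw [hg]; exact Finset.sum_le_univ_sum_of_nonneg h2
      exact ⟨by rwa [abs_of_nonneg a1, abs_of_nonneg h1], mul_nonneg a1 h1⟩
    · have a1 : ∑ j ∈ S, h j c ≤ 0 := Finset.sum_nonpos fun j _ => h2 j
      have a2 : g c ≤ ∑ j ∈ S, h j c := by
        have := Finset.sum_le_univ_sum_of_nonneg (s := S) (f := fun j => - h j c)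
          (fun j => by have := h2 j; simpa using this)
        simp only [Finset.sum_neg_distrib] at this
        rw [hg]; linarith
      exact ⟨by rw [abs_of_nonpos a1, abs_of_nonpos h1]; linarith, mul_nonneg_of_nonpos_of_nonpos a1 h1⟩
  · rintro hne ⟨j, hj⟩ h0
    apply hne j
    ext c
    have h0c : ∑ j ∈ S, h j c = 0 := by rw [← Finset.sum_apply, h0]; rfl
    rcases hcase c with ⟨h1, h2⟩ | ⟨h1, h2⟩
    · exact (Finset.sum_eq_zero_iff_of_nonneg fun j _ => h2 j).1 h0c j hj
    · exact (Finset.sum_eq_zero_iff_of_nonpos fun j _ => h2 j).1 h0c j hj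

lemma fb_vertex {ι : Type*} [DecidableEq ι] {d : ℕ} (S : Finset ι) (w : ι → Fin d → ℚ) (s : ℚ) :
    ∀ (N : ℕ) (l : ι → ℚ), (S.filter fun i => 0 < l i ∧ l i < 1).card ≤ N →
      (∀ i ∈ S, 0 ≤ l i ∧ l i ≤ 1) → ∑ i ∈ S, l i = s → (∀ c, ∑ i ∈ S, l i * w i c = 0) →
      ∃ l' : ι → ℚ, (S.filter fun i => 0 < l' i ∧ l' i < 1).card ≤ d + 1 ∧
      (∀ i ∈ S, 0 ≤ l' i ∧ l' i ≤ 1) ∧ ∑ i ∈ S, l' i = s ∧ (∀ c, ∑ i ∈ S, l' i * w i c = 0) := by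
  intro N
  induction N with
  | zero => intro l h1 h2 h3 h4; exact ⟨l, by omega, h2, h3, h4⟩
  | succ N ih =>
    intro l h1 h2 h3 h4
    by_cases hN : (S.filter fun i => 0 < l i ∧ l i < 1).card ≤ d + 1
    · exact ⟨l, hN, h2, h3, h4⟩
    push Not at hN
    set F := S.filter fun i => 0 < l i ∧ l i < 1 with hF
    have hFS : F ⊆ S := Finset.filter_subset _ _
    let M : Matrix (Option (Fin d)) F ℚ := Matrix.of fun o i => o.elim 1 (w i)
    have hker : LinearMap.ker M.mulVecLin ≠ ⊥ := by
      apply LinearMap.ker_ne_bot_of_finrank_lt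
      simp
      omega
    obtain ⟨μ, hμ, hμ0⟩ := (Submodule.ne_bot_iff _).1 hker
    have hμ1 : ∀ o : Option (Fin d), ∑ i : F, o.elim 1 (w i) * μ i = 0 := fun o => congrFun hμ o
    set μ' : ι → ℚ := fun i => if h : i ∈ F then μ ⟨i, h⟩ else 0 with hμ'
    have hμ'0 : ∀ i, i ∉ F → μ' i = 0 := fun i hi => by simp [hμ', hi]
    have hext : ∀ a : ι → ℚ, ∑ i ∈ S, μ' i * a i = ∑ i : F, a i * μ i := by
      intro a
      rw [← Finset.sum_subset hFS (fun i _ hi => by rw [hμ'0 i hi, zero_mul]),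
        ← Finset.sum_coe_sort F]
      refine Finset.sum_congr rfl fun i _ => ?_
      simp [hμ', mul_comm]
    have hsum1 : ∑ i ∈ S, μ' i = 0 := by
      have := hext fun _ => 1
      simp only [mul_one] at this
      rw [this]; exact hμ1 none
    have hsumw : ∀ c, ∑ i ∈ S, μ' i * w i c = 0 := by
      intro c
      rw [hext fun i => w i c]; exact hμ1 (some c)
    have hne : (F.filter fun i => μ' i ≠ 0).Nonempty := by
      obtain ⟨i, hi⟩ := Function.ne_iff.mp hμ0
      exact ⟨i, by simpa [hμ'] using hi⟩
    obtain ⟨i0, hi0, hmin⟩ := Finset.exists_min_image _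
      (fun i => if 0 < μ' i then (1 - l i) / μ' i else l i / (- μ' i)) hne
    set t0 := (if 0 < μ' i0 then (1 - l i0) / μ' i0 else l i0 / (- μ' i0)) with ht0
    have hi0F : i0 ∈ F := (Finset.mem_filter.1 hi0).1
    have hi0μ : μ' i0 ≠ 0 := (Finset.mem_filter.1 hi0).2
    have hFl : ∀ i ∈ F, 0 < l i ∧ l i < 1 := fun i hi => (Finset.mem_filter.1 hi).2
    have ht0pos : 0 ≤ t0 := by
      have := hFl i0 hi0F
      rw [ht0]
      split_ifs with h
      · exact div_nonneg (by linarith) h.le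
      · push Not at h
        exact div_nonneg this.1.le (by linarith)
    have hi0l : l i0 + t0 * μ' i0 = 1 ∨ l i0 + t0 * μ' i0 = 0 := by
      rw [ht0]
      split_ifs with h
      · left; field_simp; ring
      · right; field_simp; ring
    have hbox : ∀ i ∈ S, 0 ≤ l i + t0 * μ' i ∧ l i + t0 * μ' i ≤ 1 := by
      intro i hi
      have hb := h2 i hi
      rcases lt_trichotomy (μ' i) 0 with h | h | h
      · have hiF : i ∈ F := by
          by_contra hc; rw [hμ'0 i hc] at h; exact lt_irrefl _ h
        have := hmin i (Finset.mem_filter.2 ⟨hiF, h.ne⟩)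
        rw [if_neg (not_lt.2 h.le), le_div_iff₀ (by linarith)] at this
        constructor <;> nlinarith
      · rw [h]; simpa using hb
      · have hiF : i ∈ F := by
          by_contra hc; rw [hμ'0 i hc] at h; exact lt_irrefl _ h
        have := hmin i (Finset.mem_filter.2 ⟨hiF, h.ne'⟩)
        rw [if_pos h, le_div_iff₀ h] at this
        constructor <;> nlinarith
    refine ih (fun i => l i + t0 * μ' i) ?_ hbox ?_ ?_
    · have hsub : (S.filter fun i => 0 < l i + t0 * μ' i ∧ l i + t0 * μ' i < 1) ⊆ F.erase i0 := by
        intro i hi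
        obtain ⟨hiS, hi1, hi2⟩ := Finset.mem_filter.1 hi
        rw [Finset.mem_erase]
        constructor
        · rintro rfl
          rcases hi0l with h | h <;> linarith
        · by_contra hc
          rw [hμ'0 i hc] at hi1 hi2
          apply hc
          rw [hF, Finset.mem_filter]
          exact ⟨hiS, by simpa using hi1, by simpa using hi2⟩
      have := Finset.card_le_card hsub
      rw [Finset.card_erase_of_mem hi0F] at this
      omega
    · rw [Finset.sum_add_distrib, ← Finset.mul_sum, hsum1, h3]; ring
    · intro c
      simp only [add_mul, mul_assoc]
      rw [Finset.sum_add_distrib, ← Finset.mul_sum, hsumw, h4]; ring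

def fbP {ι : Type*} {d : ℕ} (w : ι → Fin d → ℚ) (S : Finset ι) : Prop :=
  S.card ≤ d ∨ ∃ l : ι → ℚ, (∀ i ∈ S, 0 ≤ l i ∧ l i ≤ 1) ∧ ∑ i ∈ S, l i = (S.card : ℚ) - d ∧
    (∀ c, ∑ i ∈ S, l i * w i c = 0)

lemma fb_step {ι : Type*} [DecidableEq ι] {d : ℕ} (w : ι → Fin d → ℚ) (S : Finset ι)
    (hS : S.Nonempty) (hP : fbP w S) : ∃ i ∈ S, fbP w (S.erase i) := by
  by_cases hd : S.card ≤ d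
  · obtain ⟨i, hi⟩ := hS
    exact ⟨i, hi, Or.inl ((Finset.card_le_card (Finset.erase_subset _ _)).trans hd)⟩
  rcases hP with h | ⟨l, h1, h2, h3⟩
  · exact absurd h hd
  push Not at hd
  have hdq : (d : ℚ) + 1 ≤ S.card := by exact_mod_cast hd
  set r : ℚ := ((S.card : ℚ) - d - 1) / ((S.card : ℚ) - d) with hr
  have hden : 0 < (S.card : ℚ) - d := by linarith
  have hr0 : 0 ≤ r := div_nonneg (by linarith) hden.le
  have hr1 : r ≤ 1 := by rw [hr, div_le_one hden]; linarith
  obtain ⟨l', a1, a2, a3, a4⟩ := fb_vertex S w ((S.card : ℚ) - d - 1) _ (fun i => r * l i) le_rfl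
    (fun i hi => ⟨mul_nonneg hr0 (h1 i hi).1, mul_le_one₀ hr1 (h1 i hi).1 (h1 i hi).2⟩)
    (by rw [← Finset.mul_sum, h2, hr]; field_simp)
    (fun c => by simp only [mul_assoc]; rw [← Finset.mul_sum, h3, mul_zero])
  have hz : ∃ i ∈ S, l' i = 0 := by
    by_contra hc
    push Not at hc
    have hpos : ∀ i ∈ S, 0 < l' i := fun i hi => lt_of_le_of_ne (a2 i hi).1 (hc i hi).symm
    set F := S.filter fun i => 0 < l' i ∧ l' i < 1 with hF
    have hone : ∀ i ∈ S, i ∉ F → 1 - l' i = 0 := by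
      intro i hi hiF
      rw [hF, Finset.mem_filter] at hiF
      have := a2 i hi
      have := hpos i hi
      have : ¬ l' i < 1 := fun h => hiF ⟨hi, ‹_›, h⟩
      linarith
    have e1 : ∑ i ∈ S, (1 - l' i) = ∑ i ∈ F, (1 - l' i) :=
      (Finset.sum_subset (Finset.filter_subset _ _) hone).symm
    have e2 : ∑ i ∈ S, (1 - l' i) = d + 1 := by
      rw [Finset.sum_sub_distrib, a3]; simp; ring
    have hFne : F.Nonempty := by
      by_contra hne
      rw [Finset.not_nonempty_iff_eq_empty] at hne
      rw [hne, Finset.sum_empty, e2] at e1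
      have : (0:ℚ) ≤ d := Nat.cast_nonneg d
      linarith
    have e3 : ∑ i ∈ F, (1 - l' i) < ∑ i ∈ F, (1 : ℚ) := by
      apply Finset.sum_lt_sum_of_nonempty hFne
      intro i hi
      have := (Finset.mem_filter.1 hi).2.1
      linarith
    have e4 : (F.card : ℚ) ≤ d + 1 := by exact_mod_cast a1
    simp at e3
    simp at e1 e2
    linarith
  obtain ⟨i, hi, hi0⟩ := hz
  refine ⟨i, hi, Or.inr ⟨l', fun j hj => a2 j (Finset.mem_of_mem_erase hj), ?_, fun c => ?_⟩⟩
  · rw [Finset.sum_erase S hi0, a3, Finset.card_erase_of_mem hi, Nat.cast_sub (by omega)]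
    push_cast; ring
  · rw [Finset.sum_erase S (by rw [hi0, zero_mul]), a4]

lemma fb_bound {ι : Type*} {d : ℕ} (w : ι → Fin d → ℚ) (W : ℚ)
    (hw : ∀ i c, |w i c| ≤ W) (hW : 0 ≤ W) (S : Finset ι)
    (hP : fbP w S) (c : Fin d) : |∑ i ∈ S, w i c| ≤ d * W := by
  rcases hP with h | ⟨l, h1, h2, h3⟩
  · calc |∑ i ∈ S, w i c| ≤ ∑ i ∈ S, |w i c| := Finset.abs_sum_le_sum_abs _ _
      _ ≤ ∑ i ∈ S, W := Finset.sum_le_sum fun i _ => hw i c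
      _ = S.card * W := by simp
      _ ≤ d * W := by gcongr
  · have e : ∑ i ∈ S, w i c = ∑ i ∈ S, (1 - l i) * w i c := by
      simp only [sub_mul, one_mul]
      rw [Finset.sum_sub_distrib, h3, sub_zero]
    rw [e]
    calc |∑ i ∈ S, (1 - l i) * w i c| ≤ ∑ i ∈ S, |(1 - l i) * w i c| :=
          Finset.abs_sum_le_sum_abs _ _
      _ ≤ ∑ i ∈ S, (1 - l i) * W := by
          refine Finset.sum_le_sum fun i hi => ?_
          have := (h1 i hi).2
          rw [abs_mul, abs_of_nonneg (by linarith)]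
          exact mul_le_mul_of_nonneg_left (hw i c) (by linarith)
      _ = d * W := by
          rw [← Finset.sum_mul, Finset.sum_sub_distrib, h2]; simp

lemma fb_steinitz {N d : ℕ} (v : Fin N → Fin d → ℤ) (W : ℕ)
    (hv : ∀ i c, |v i c| ≤ (W : ℤ)) (hs : ∑ i, v i = 0) (hN : (2 * (d * W) + 1) ^ d < N) :
    ∃ S : Finset (Fin N), S.Nonempty ∧ Sᶜ.Nonempty ∧ ∑ i ∈ S, v i = 0 := by
  set w : Fin N → Fin d → ℚ := fun i c => (v i c : ℚ) with hw
  have hwW : ∀ i c, |w i c| ≤ (W : ℚ) := by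
    intro i c
    have := hv i c
    simp only [hw]
    exact_mod_cast this
  have hstep : ∀ S : Finset (Fin N), ∃ S', S.Nonempty → fbP w S →
      S' ⊆ S ∧ S'.card + 1 = S.card ∧ fbP w S' := by
    intro S
    by_cases h : S.Nonempty ∧ fbP w S
    · obtain ⟨i, hi, hP⟩ := fb_step w S h.1 h.2
      exact ⟨S.erase i, fun _ _ => ⟨Finset.erase_subset _ _, Finset.card_erase_add_one hi, hP⟩⟩
    · exact ⟨S, fun h1 h2 => absurd ⟨h1, h2⟩ h⟩
  choose f hf using hstep
  set U : ℕ → Finset (Fin N) := fun j => f^[j] Finset.univ with hU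
  have hUs : ∀ j, U (j + 1) = f (U j) := fun j => Function.iterate_succ_apply' _ _ _
  have h0 : fbP w (U 0) := by
    by_cases hdN : N ≤ d
    · left; simpa [hU] using hdN
    push Not at hdN
    right
    have hNq : (d : ℚ) < N := by exact_mod_cast hdN
    have hNp : (0 : ℚ) < N := lt_of_le_of_lt (Nat.cast_nonneg d) hNq
    refine ⟨fun _ => ((N : ℚ) - d) / N, fun i _ => ⟨div_nonneg (by linarith) hNp.le, ?_⟩, ?_, ?_⟩
    · rw [div_le_one hNp]
      have : (0:ℚ) ≤ d := Nat.cast_nonneg d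
      linarith
    · simp [hU]; field_simp
    · intro c
      rw [← Finset.mul_sum]
      have : ∑ i, v i c = 0 := by rw [← Finset.sum_apply, hs]; rfl
      have : ∑ i, w i c = 0 := by simp only [hw]; exact_mod_cast this
      simp only [hU, Function.iterate_zero, id_eq]
      rw [this, mul_zero]
  have hinv : ∀ j, j ≤ N → fbP w (U j) ∧ (U j).card + j = N := by
    intro j
    induction j with
    | zero => intro _; exact ⟨h0, by simp [hU]⟩
    | succ j ih =>
      intro hj
      obtain ⟨a1, a2⟩ := ih (by omega)
      have := hf (U j) (Finset.card_pos.1 (by omega)) a1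
      rw [hUs]
      exact ⟨this.2.2, by omega⟩
  have hmono : ∀ j k, j ≤ k → k ≤ N → U k ⊆ U j := by
    intro j k hjk
    induction k, hjk using Nat.le_induction with
    | base => intro _; exact subset_rfl
    | succ k hjk ih =>
      intro hk
      obtain ⟨a1, a2⟩ := hinv k (by omega)
      have := hf (U k) (Finset.card_pos.1 (by omega)) a1
      rw [hUs]
      exact this.1.trans (ih (by omega))
  have hbd : ∀ j, j ≤ N → ∀ c, |∑ i ∈ U j, v i c| ≤ ((d * W : ℕ) : ℤ) := by
    intro j hj c
    have := fb_bound w W hwW (Nat.cast_nonneg W) _ (hinv j hj).1 c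
    simp only [hw] at this
    exact_mod_cast this
  obtain ⟨j, hj, k, hk, hjk, heq⟩ := Finset.exists_ne_map_eq_of_card_lt_of_maps_to
    (s := Finset.range N)
    (t := Fintype.piFinset fun _ : Fin d => Finset.Icc (-((d * W : ℕ) : ℤ)) ((d * W : ℕ) : ℤ))
    (f := fun j => ∑ i ∈ U j, v i)
    (by
      rw [Fintype.card_piFinset]
      simp only [Int.card_Icc, Finset.prod_const, Finset.card_univ, Fintype.card_fin,
        Finset.card_range]
      convert hN using 2
      omega)
    (by
      intro j hj
      have hj := Finset.mem_range.1 hj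
      rw [Finset.mem_coe, Fintype.mem_piFinset]
      intro c
      rw [Finset.mem_Icc]
      beta_reduce
      rw [Finset.sum_apply]
      exact abs_le.1 (hbd j hj.le c))
  have main : ∀ j k, j < k → k < N → ∑ i ∈ U j, v i = ∑ i ∈ U k, v i →
      ∃ S : Finset (Fin N), S.Nonempty ∧ Sᶜ.Nonempty ∧ ∑ i ∈ S, v i = 0 := by
    intro j k hjk hk he
    have hsub := hmono j k hjk.le hk.le
    have c1 := (hinv j (by omega)).2
    have c2 := (hinv k (by omega)).2
    refine ⟨U j \ U k, ?_, ?_, ?_⟩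
    · rw [← Finset.card_pos, Finset.card_sdiff_of_subset hsub]; omega
    · obtain ⟨i, hi⟩ : (U k).Nonempty := Finset.card_pos.1 (by omega)
      exact ⟨i, by simp [hi]⟩
    · have := Finset.sum_sdiff (f := v) hsub
      rw [he] at this
      simpa using this
  rw [Finset.mem_range] at hj hk
  rcases lt_or_gt_of_ne hjk with h | h
  · exact main j k h hk heq
  · exact main k j h hj heq.symm
/-- The `ℓ∞`-norm of any Graver basis element of a 4-block n-fold matrix is at most
`c · n^{s_C}` where `c` depends only on the parameters of the small matrices. -/
theorem graver_upper_bound_fourBlock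
    (sA tA sC tB Δ : ℕ) (hsA : 0 < sA) (htA : 0 < tA) (hsC : 0 < sC)
    (htB : 0 < tB) (hΔ : 0 < Δ) :
    ∃ c : ℕ, ∀ n : ℕ, 1 ≤ n →
      ∀ (A : Matrix (Fin sA) (Fin tA) ℤ) (B : Matrix (Fin sA) (Fin tB) ℤ)
        (C : Matrix (Fin sC) (Fin tB) ℤ) (D : Matrix (Fin sC) (Fin tA) ℤ),
      (∀ i j, |A i j| ≤ (Δ : ℤ)) → (∀ i j, |B i j| ≤ (Δ : ℤ)) →
      (∀ i j, |C i j| ≤ (Δ : ℤ)) → (∀ i j, |D i j| ≤ (Δ : ℤ)) →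
      ∀ g ∈ graverBasis (fourBlock n sA tA sC tB A B C D),
      ∀ i, |g i| ≤ (c : ℤ) * (n : ℤ) ^ sC := by
  classical
  choose K hK using fun AB : Matrix (Fin sA) (Fin tA) ℤ × Matrix (Fin sA) (Fin tB) ℤ =>
    fb_twoStage AB.1 AB.2
  have hKb : ∃ K0 : ℕ, ∀ (A : Matrix (Fin sA) (Fin tA) ℤ) (B : Matrix (Fin sA) (Fin tB) ℤ),
      (∀ i j, |A i j| ≤ (Δ : ℤ)) → (∀ i j, |B i j| ≤ (Δ : ℤ)) → K (A, B) ≤ K0 := by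
    let FA : Finset (Fin sA → Fin tA → ℤ) := Fintype.piFinset fun _ => Fintype.piFinset fun _ =>
      Finset.Icc (-(Δ : ℤ)) Δ
    let FB : Finset (Fin sA → Fin tB → ℤ) := Fintype.piFinset fun _ => Fintype.piFinset fun _ =>
      Finset.Icc (-(Δ : ℤ)) Δ
    refine ⟨∑ a ∈ FA, ∑ b ∈ FB, K (Matrix.of a, Matrix.of b), fun A B hA hB => ?_⟩
    have hA' : (fun i j => A i j) ∈ FA := by
      simp only [FA, Fintype.mem_piFinset, Finset.mem_Icc]
      exact fun i j => abs_le.1 (hA i j)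
    have hB' : (fun i j => B i j) ∈ FB := by
      simp only [FB, Fintype.mem_piFinset, Finset.mem_Icc]
      exact fun i j => abs_le.1 (hB i j)
    exact (Finset.single_le_sum (f := fun b => K (A, Matrix.of b)) (fun _ _ => Nat.zero_le _)
      hB').trans (Finset.single_le_sum (f := fun a => ∑ b ∈ FB, K (Matrix.of a, Matrix.of b))
      (fun _ _ => Nat.zero_le _) hA')
  obtain ⟨K0, hK0⟩ := hKb
  set W : ℕ := Δ * K0 * (tA + tB) with hW
  refine ⟨(2 * (sC * W) + 1) ^ sC * K0, ?_⟩
  intro n hn A B C D hA hB hC hD g hg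
  obtain ⟨hg1, hg2, hg3⟩ := hg
  set H := fourBlock n sA tA sC tB A B C D with hH
  let T : AddSubgroup (Fin tB ⊕ Fin n × Fin tA → ℤ) :=
    { carrier := {g | ∀ r, H.mulVec g (Sum.inr r) = 0}
      add_mem' := by
        intro a b ha hb r
        rw [Matrix.mulVec_add, Pi.add_apply, ha r, hb r, add_zero]
      zero_mem' := by intro r; rw [Matrix.mulVec_zero]; rfl
      neg_mem' := by
        intro a ha r
        rw [Matrix.mulVec_neg, Pi.neg_apply, ha r, neg_zero] }
  obtain ⟨N, h, hsum, hprop⟩ := fb_decomp T (K0 : ℤ) (by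
    intro g' hg' hne
    obtain ⟨h, a1, a2, a3, a4⟩ := hK (A, B) n sC C D g' hne hg'
    refine ⟨h, a2, a1, a3, fun c => (a4 c).trans ?_⟩
    exact_mod_cast hK0 A B hA hB) _ g (fun r => by rw [hg1]; rfl) le_rfl
  have hb : ∀ j c, |h j c| ≤ (K0 : ℤ) := fun j => (hprop j).2.2.2
  have hc : ∀ j, conformal (h j) g := fun j => (hprop j).2.2.1
  have hne : ∀ j, h j ≠ 0 := fun j => (hprop j).2.1
  let v : Fin N → Fin sC → ℤ := fun j i => H.mulVec (h j) (Sum.inl i)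
  have hvsum : ∀ S : Finset (Fin N), ∀ r, H.mulVec (∑ j ∈ S, h j) r = ∑ j ∈ S, H.mulVec (h j) r := by
    intro S r
    rw [Matrix.mulVec_sum, Finset.sum_apply]
  have hNle : N ≤ (2 * (sC * (n * W)) + 1) ^ sC := by
    by_contra hcon
    push Not at hcon
    obtain ⟨S, hS1, hS2, hS3⟩ := fb_steinitz v (n * W) (by
      intro j i
      simp only [v, hH]
      rw [fb_mulVec_inl]
      have e1 : |∑ l, C i l * h j (Sum.inl l)| ≤ tB * ((Δ : ℤ) * K0) := by
        refine (Finset.abs_sum_le_sum_abs _ _).trans ?_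
        refine (Finset.sum_le_card_nsmul _ _ ((Δ : ℤ) * K0) fun l _ => ?_).trans (by simp)
        rw [abs_mul]
        exact mul_le_mul (hC i l) (hb _ _) (abs_nonneg _) (by positivity)
      have e2 : |∑ k : Fin n, ∑ l, D i l * h j (Sum.inr (k, l))| ≤ n * (tA * ((Δ : ℤ) * K0)) := by
        refine (Finset.abs_sum_le_sum_abs _ _).trans ?_
        refine (Finset.sum_le_card_nsmul _ _ (tA * ((Δ : ℤ) * K0)) fun k _ => ?_).trans (by simp)
        refine (Finset.abs_sum_le_sum_abs _ _).trans ?_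
        refine (Finset.sum_le_card_nsmul _ _ ((Δ : ℤ) * K0) fun l _ => ?_).trans (by simp)
        rw [abs_mul]
        exact mul_le_mul (hD i l) (hb _ _) (abs_nonneg _) (by positivity)
      refine (abs_add_le _ _).trans ((add_le_add e1 e2).trans ?_)
      rw [hW]
      push_cast
      have hn' : (1 : ℤ) ≤ n := by exact_mod_cast hn
      have : (tB : ℤ) * (Δ * K0) ≤ n * (tB * (Δ * K0)) :=
        le_mul_of_one_le_left (by positivity) hn'
      linarith) (by
      ext i
      have := hvsum Finset.univ (Sum.inl i)
      rw [hsum, hg1] at this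
      rw [Finset.sum_apply]
      exact this.symm) hcon
    have hz := hg3 (∑ j ∈ S, h j) (by
      ext r
      rw [hvsum]
      rcases r with i | r
      · have := congrFun hS3 i
        rw [Finset.sum_apply] at this
        exact this
      · exact Finset.sum_eq_zero fun j _ => (hprop j).1 r)
      ((fb_subsum h g hsum hc S).2 hne hS1) (fb_subsum h g hsum hc S).1
    apply (fb_subsum h g hsum hc Sᶜ).2 hne hS2
    have := Finset.sum_add_sum_compl S h
    rw [hz, hsum] at this
    simpa using this
  have hNle2 : N ≤ (2 * (sC * W) + 1) ^ sC * n ^ sC := by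
    rw [← mul_pow]
    refine hNle.trans (Nat.pow_le_pow_left ?_ _)
    nlinarith
  intro c
  have e : |g c| ≤ N * (K0 : ℤ) := by
    rw [← hsum, Finset.sum_apply]
    refine (Finset.abs_sum_le_sum_abs _ _).trans ?_
    exact (Finset.sum_le_card_nsmul _ _ (K0 : ℤ) fun j _ => hb j c).trans (by simp)
  refine e.trans ?_
  have : N * K0 ≤ (2 * (sC * W) + 1) ^ sC * K0 * n ^ sC := by
    calc N * K0 ≤ ((2 * (sC * W) + 1) ^ sC * n ^ sC) * K0 := Nat.mul_le_mul_right _ hNle2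
      _ = _ := by ring
  exact_mod_cast this
end

section
/- Let κ, ζ ≥ 1 be integers and let z_1, …, z_m ∈ Z^κ satisfy ‖z_i‖_∞ ≤ ζ for every i and z_1 + z_2 + … + z_m = 0. If m > (2κζ+1)^κ + 1, then there exists a nonempty proper subset S of {1, …, m} such that Σ_{i∈S} z_i = 0. -/
def SteinP {ι : Type} [Fintype ι] {d : ℕ} (v : ι → Fin d → ℝ) (A : Finset ι) (s : ℝ) :
    Set (ι → ℝ) :=
  {μ | (∀ i, 0 ≤ μ i) ∧ (∀ i, μ i ≤ 1) ∧ (∀ i, i ∉ A → μ i = 0) ∧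
    (∀ j, ∑ i, μ i * v i j = 0) ∧ ∑ i, μ i = s}

theorem SteinP_compact {ι : Type} [Fintype ι] {d : ℕ} (v : ι → Fin d → ℝ) (A : Finset ι) (s : ℝ) :
    IsCompact (SteinP v A s) := by
  have h1 : IsCompact (Set.Icc (0 : ι → ℝ) 1) := isCompact_Icc
  refine h1.of_isClosed_subset ?_ ?_
  · unfold SteinP
    simp only [Set.ofPred_and, Set.ofPred_forall]
    refine IsClosed.inter ?_ (IsClosed.inter ?_ (IsClosed.inter ?_ (IsClosed.inter ?_ ?_)))
    · exact isClosed_iInter fun i => isClosed_le (by fun_prop) (by fun_prop)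
    · exact isClosed_iInter fun i => isClosed_le (by fun_prop) (by fun_prop)
    · exact isClosed_iInter fun i => isClosed_iInter fun _ =>
        isClosed_eq (by fun_prop) (by fun_prop)
    · exact isClosed_iInter fun i => isClosed_eq (by fun_prop) (by fun_prop)
    · exact isClosed_eq (by fun_prop) (by fun_prop)
  · intro μ h
    exact ⟨fun i => h.1 i, fun i => h.2.1 i⟩

theorem SteinP_step {ι : Type} [Fintype ι] [DecidableEq ι] {d : ℕ} (v : ι → Fin d → ℝ)
    (A : Finset ι) (s : ℝ) (hs : s = (A.card : ℝ) - d - 1) (hne : (SteinP v A s).Nonempty) :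
    ∃ i ∈ A, (SteinP v (A.erase i) s).Nonempty := by
  obtain ⟨μ, hμ⟩ := (SteinP_compact v A s).extremePoints_nonempty hne
  obtain ⟨⟨h0, h1, hA, hv, hS⟩, hext⟩ := hμ
  by_contra hcon
  have hpos : ∀ i ∈ A, 0 < μ i := by
    intro i hi
    refine lt_of_le_of_ne (h0 i) fun h => hcon ⟨i, hi, μ, h0, h1, ?_, hv, hS⟩
    intro k hk
    by_cases hki : k = i
    · rw [hki, ← h]
    · exact hA k fun hkA => hk (Finset.mem_erase.2 ⟨hki, hkA⟩)
  set F := A.filter (fun i => μ i < 1) with hF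
  have hcard : F.card ≤ d + 1 := by
    by_contra hlt
    have hnl : ¬ LinearIndepOn ℝ (fun i => ((v i, (1 : ℝ)) : (Fin d → ℝ) × ℝ)) (F : Set ι) := by
      intro hli
      have := LinearIndependent.fintype_card_le_finrank hli
      simp at this
      omega
    rw [not_linearIndepOn_finset_iff] at hnl
    obtain ⟨f, hf, i0, hi0, hfi0⟩ := hnl
    set g : ι → ℝ := fun i => if i ∈ F then f i else 0 with hg
    have hg1 : ∑ i, g i = 0 := by
      have := congrArg Prod.snd hf
      simp [Prod.snd_sum] at this
      simp [hg, this]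
    have hg2 : ∀ j, ∑ i, g i * v i j = 0 := by
      intro j
      have := congrFun (congrArg Prod.fst hf) j
      simp [Prod.fst_sum] at this
      simp [hg, ite_mul, this]
    have hev : ∀ᶠ ε : ℝ in nhdsWithin 0 (Set.Ioi 0), ∀ i ∈ F,
        (0 < μ i + ε * g i ∧ μ i + ε * g i < 1) ∧ (0 < μ i - ε * g i ∧ μ i - ε * g i < 1) := by
      refine Filter.Eventually.filter_mono nhdsWithin_le_nhds ?_
      rw [Filter.eventually_all_finset]
      intro i hi
      rw [hF, Finset.mem_filter] at hi
      have a := hpos i hi.1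
      have b := hi.2
      have c1 : Filter.Tendsto (fun ε : ℝ => μ i + ε * g i) (nhds 0) (nhds (μ i)) := by
        have : Continuous (fun ε : ℝ => μ i + ε * g i) := by fun_prop
        simpa using this.tendsto 0
      have c2 : Filter.Tendsto (fun ε : ℝ => μ i - ε * g i) (nhds 0) (nhds (μ i)) := by
        have : Continuous (fun ε : ℝ => μ i - ε * g i) := by fun_prop
        simpa using this.tendsto 0
      exact ((c1.eventually_const_lt a).and (c1.eventually_lt_const b)).and
        ((c2.eventually_const_lt a).and (c2.eventually_lt_const b))
    obtain ⟨ε, hε, hεpos⟩ := (hev.and self_mem_nhdsWithin).exists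
    have hεpos : 0 < ε := hεpos
    have key : ∀ t : ℝ, (∀ i ∈ F, 0 < μ i + t * g i ∧ μ i + t * g i < 1) →
        (fun i => μ i + t * g i) ∈ SteinP v A s := by
      intro t ht
      have hout : ∀ i, i ∉ F → g i = 0 := fun i hi => by simp [hg, hi]
      refine ⟨fun i => ?_, fun i => ?_, fun i hi => ?_, fun j => ?_, ?_⟩
      · by_cases hi : i ∈ F
        · exact (ht i hi).1.le
        · simpa [hout i hi] using h0 i
      · by_cases hi : i ∈ F
        · exact (ht i hi).2.le
        · simpa [hout i hi] using h1 i
      · have : i ∉ F := fun h => hi (Finset.mem_filter.1 h).1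
        simp [hout i this, hA i hi]
      · simp only [add_mul, Finset.sum_add_distrib, mul_assoc, ← Finset.mul_sum, hv, hg2]
        simp
      · simp only [Finset.sum_add_distrib, ← Finset.mul_sum, hS, hg1]
        simp
    have k1 := key ε fun i hi => (hε i hi).1
    have k2 := key (-ε) fun i hi => by
      have := (hε i hi).2
      simpa [sub_eq_add_neg] using this
    have hseg : μ ∈ openSegment ℝ (fun i => μ i + ε * g i) (fun i => μ i + (-ε) * g i) := by
      refine ⟨1/2, 1/2, by norm_num, by norm_num, by norm_num, ?_⟩
      funext i
      simp
      ring
    have := hext k1 k2 hseg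
    have := congrFun this i0
    simp [hg, hi0, hfi0, hεpos.ne'] at this
  have hsumA : ∑ i ∈ A, μ i = s := by
    rw [← hS]
    exact Finset.sum_subset (Finset.subset_univ _) fun i _ hi => hA i hi
  have e1 : ∑ i ∈ A, (1 - μ i) = d + 1 := by
    rw [Finset.sum_sub_distrib, hsumA, hs]
    simp
    ring
  have e2 : ∑ i ∈ F, (1 - μ i) = d + 1 := by
    rw [← e1]
    refine Finset.sum_subset (Finset.filter_subset _ _) fun i hi hiF => ?_
    have : ¬ μ i < 1 := fun h => hiF (Finset.mem_filter.2 ⟨hi, h⟩)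
    have := h1 i
    linarith
  have hFne : F.Nonempty := by
    rw [Finset.nonempty_iff_ne_empty]
    intro h
    rw [h] at e2
    simp at e2
    have : (0 : ℝ) ≤ d := Nat.cast_nonneg d
    linarith
  have e3 : ∑ i ∈ F, (1 - μ i) < ∑ i ∈ F, (1 : ℝ) :=
    Finset.sum_lt_sum_of_nonempty hFne fun i hi => by
      have := hpos i (Finset.mem_filter.1 hi).1
      linarith
  rw [e2] at e3
  simp at e3
  have : (F.card : ℝ) ≤ d + 1 := by exact_mod_cast hcard
  linarith

def SteinGood {ι : Type} [Fintype ι] {d : ℕ} (v : ι → Fin d → ℝ) (A : Finset ι) : Prop :=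
  A.card ≤ d ∨ (SteinP v A ((A.card : ℝ) - d)).Nonempty

theorem SteinGood_step {ι : Type} [Fintype ι] [DecidableEq ι] {d : ℕ} (v : ι → Fin d → ℝ)
    (A : Finset ι) (hne : A.Nonempty) (h : SteinGood v A) :
    ∃ i ∈ A, SteinGood v (A.erase i) := by
  by_cases hc : A.card ≤ d
  · obtain ⟨i, hi⟩ := hne
    exact ⟨i, hi, Or.inl ((Finset.card_le_card (Finset.erase_subset _ _)).trans hc)⟩
  · obtain ⟨μ, h0, h1, hA, hv, hS⟩ := h.resolve_left hc
    have hc' : (d : ℝ) + 1 ≤ A.card := by exact_mod_cast (by omega : d + 1 ≤ A.card)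
    set c : ℝ := ((A.card : ℝ) - d - 1) / (A.card - d) with hcdef
    have hp : (0 : ℝ) < A.card - d := by linarith
    have c0 : 0 ≤ c := div_nonneg (by linarith) hp.le
    have c1 : c ≤ 1 := (div_le_one hp).2 (by linarith)
    obtain ⟨i, hi, hP⟩ := SteinP_step v A _ rfl ⟨fun i => c * μ i, fun i => mul_nonneg c0 (h0 i),
      fun i => mul_le_one₀ c1 (h0 i) (h1 i), fun i hi => by simp [hA i hi],
      fun j => by simp only [mul_assoc, ← Finset.mul_sum, hv, mul_zero],
      by rw [← Finset.mul_sum, hS, hcdef]; field_simp⟩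
    refine ⟨i, hi, Or.inr ?_⟩
    have : ((A.erase i).card : ℝ) - d = A.card - d - 1 := by
      have := Finset.card_erase_add_one hi
      rw [← this]; push_cast; ring
    rw [this]
    exact hP

theorem SteinGood_bound {ι : Type} [Fintype ι] [DecidableEq ι] {d : ℕ} (v : ι → Fin d → ℝ)
    (A : Finset ι) (h : SteinGood v A) (b : ℝ) (hb0 : 0 ≤ b) (hb : ∀ i j, |v i j| ≤ b)
    (j : Fin d) : |∑ i ∈ A, v i j| ≤ d * b := by
  rcases h with h | ⟨μ, h0, h1, hA, hv, hS⟩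
  · calc |∑ i ∈ A, v i j| ≤ ∑ i ∈ A, |v i j| := Finset.abs_sum_le_sum_abs _ _
      _ ≤ ∑ i ∈ A, b := Finset.sum_le_sum fun i _ => hb i j
      _ = A.card * b := by simp
      _ ≤ d * b := by gcongr
  · have hsumA : ∑ i ∈ A, μ i = A.card - d := by
      rw [← hS]
      exact Finset.sum_subset (Finset.subset_univ _) fun i _ hi => hA i hi
    have hvA : ∑ i ∈ A, μ i * v i j = 0 := by
      rw [← hv j]
      exact Finset.sum_subset (Finset.subset_univ _) fun i _ hi => by simp [hA i hi]
    calc |∑ i ∈ A, v i j| = |∑ i ∈ A, (1 - μ i) * v i j| := by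
          simp only [sub_mul, Finset.sum_sub_distrib, hvA, one_mul, sub_zero]
      _ ≤ ∑ i ∈ A, |(1 - μ i) * v i j| := Finset.abs_sum_le_sum_abs _ _
      _ ≤ ∑ i ∈ A, (1 - μ i) * b := Finset.sum_le_sum fun i _ => by
          have := h1 i
          rw [abs_mul, abs_of_nonneg (by linarith : 0 ≤ 1 - μ i)]
          exact mul_le_mul_of_nonneg_left (hb i j) (by linarith)
      _ = d * b := by
          rw [← Finset.sum_mul, Finset.sum_sub_distrib, hsumA]
          simp

theorem Stein_chain {ι : Type} [Fintype ι] [DecidableEq ι] {d : ℕ} (v : ι → Fin d → ℝ) (n : ℕ) :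
    ∀ A : Finset ι, A.card = n → SteinGood v A →
    ∃ C : Finset (Finset ι), C.card = n ∧ (∀ B ∈ C, B.Nonempty ∧ B ⊆ A ∧ SteinGood v B) ∧
      (∀ B ∈ C, ∀ D ∈ C, B ⊆ D ∨ D ⊆ B) := by
  induction n with
  | zero => exact fun A _ _ => ⟨∅, by simp⟩
  | succ n ih =>
    intro A hA hG
    have hne : A.Nonempty := Finset.card_pos.1 (by omega)
    obtain ⟨i, hi, hGi⟩ := SteinGood_step v A hne hG
    obtain ⟨C, hC, hC1, hC2⟩ := ih (A.erase i) (by rw [Finset.card_erase_of_mem hi]; omega) hGi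
    have hsub : ∀ B ∈ C, B ⊆ A := fun B hB => (hC1 B hB).2.1.trans (Finset.erase_subset _ _)
    have hAC : A ∉ C := fun h => Finset.notMem_erase i A ((hC1 A h).2.1 hi)
    refine ⟨insert A C, by rw [Finset.card_insert_of_notMem hAC, hC], ?_, ?_⟩
    · intro B hB
      rcases Finset.mem_insert.1 hB with rfl | hB
      · exact ⟨hne, subset_rfl, hG⟩
      · exact ⟨(hC1 B hB).1, hsub B hB, (hC1 B hB).2.2⟩
    · intro B hB D hD
      rcases Finset.mem_insert.1 hB with hB1 | hB1
      · rcases Finset.mem_insert.1 hD with hD1 | hD1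
        · exact Or.inl (by rw [hB1, hD1])
        · exact Or.inr (by rw [hB1]; exact hsub D hD1)
      · rcases Finset.mem_insert.1 hD with hD1 | hD1
        · exact Or.inl (by rw [hD1]; exact hsub B hB1)
        · exact hC2 B hB1 D hD1

/-- If `m` integer vectors in `ℤ^κ`, each of `ℓ∞`-norm at most `ζ`, sum to `0` and
`m > (2κζ+1)^κ + 1`, then some nonempty proper subset of them also sums to `0`. -/
theorem zero_subsum_of_many (κ ζ : ℕ) (hκ : 1 ≤ κ) (hζ : 1 ≤ ζ)
    (m : ℕ) (z : Fin m → Fin κ → ℤ)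
    (hbound : ∀ i j, |z i j| ≤ (ζ : ℤ))
    (hsum : ∑ i, z i = 0)
    (hm : (2 * κ * ζ + 1) ^ κ + 1 < m) :
    ∃ S : Finset (Fin m), S.Nonempty ∧ S ≠ Finset.univ ∧ ∑ i ∈ S, z i = 0 := by
  classical
  set v : Fin m → Fin κ → ℝ := fun i j => (z i j : ℝ) with hv
  have hvb : ∀ i j, |v i j| ≤ (ζ : ℝ) := fun i j => by
    have := hbound i j
    simp only [hv]
    exact_mod_cast this
  have hG : SteinGood v Finset.univ := by
    by_cases hc : (Finset.univ : Finset (Fin m)).card ≤ κ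
    · exact Or.inl hc
    · right
      simp only [Finset.card_univ, Fintype.card_fin] at hc ⊢
      have hlt : (κ : ℝ) < m := by exact_mod_cast (by omega : κ < m)
      have hm0 : (0 : ℝ) < m := lt_of_le_of_lt (Nat.cast_nonneg κ) hlt
      refine ⟨fun _ => ((m : ℝ) - κ) / m, fun _ => div_nonneg (by linarith) hm0.le,
        fun _ => (div_le_one hm0).2 (by have : (0:ℝ) ≤ κ := Nat.cast_nonneg κ
                                        linarith),
        fun i hi => absurd (Finset.mem_univ i) hi, fun j => ?_, ?_⟩
      · have := congrFun hsum j
        simp only [Finset.sum_apply, Pi.zero_apply] at this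
        have h2 : ∑ i, v i j = 0 := by
          simp only [hv]
          exact_mod_cast this
        rw [← Finset.mul_sum, h2, mul_zero]
      · simp
        field_simp
  obtain ⟨C, hC, hC1, hC2⟩ := Stein_chain v m Finset.univ (by simp) hG
  set T : Finset (Fin κ → ℤ) :=
    Fintype.piFinset fun _ => Finset.Icc (-((κ * ζ : ℕ) : ℤ)) ((κ * ζ : ℕ) : ℤ) with hT
  have hTc : T.card = (2 * κ * ζ + 1) ^ κ := by
    rw [hT, Fintype.card_piFinset]
    simp only [Int.card_Icc, Finset.prod_const, Finset.card_univ, Fintype.card_fin]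
    congr 1
    have : 2 * κ * ζ = κ * ζ + κ * ζ := by ring
    omega
  have hlt : T.card < (C.erase Finset.univ).card := by
    have := Finset.pred_card_le_card_erase (s := C) (a := Finset.univ)
    omega
  obtain ⟨B, hB, D, hD, hBD, heq⟩ := Finset.exists_ne_map_eq_of_card_lt_of_maps_to hlt
    (f := fun B => ∑ i ∈ B, z i) (by
      intro B hB
      have hB' := hC1 B (Finset.mem_of_mem_erase hB)
      simp only [hT, Finset.mem_coe, Fintype.mem_piFinset, Finset.mem_Icc]
      intro j
      have := SteinGood_bound v B hB'.2.2 ζ (Nat.cast_nonneg _) hvb j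
      rw [← abs_le, Finset.sum_apply]
      simp only [hv] at this
      exact_mod_cast this)
  have main : ∀ B ∈ C.erase Finset.univ, ∀ D ∈ C.erase Finset.univ, B ≠ D →
      ∑ i ∈ B, z i = ∑ i ∈ D, z i → B ⊆ D →
      ∃ S : Finset (Fin m), S.Nonempty ∧ S ≠ Finset.univ ∧ ∑ i ∈ S, z i = 0 := by
    intro B hB D hD hBD heq hsub
    refine ⟨D \ B, ?_, ?_, ?_⟩
    · rw [Finset.sdiff_nonempty]
      exact fun h => hBD (hsub.antisymm h)
    · intro h
      apply Finset.ne_of_mem_erase hD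
      exact Finset.univ_subset_iff.1 (h ▸ Finset.sdiff_subset)
    · have := Finset.sum_sdiff (f := z) hsub
      rw [heq] at this
      simpa using this
  rcases hC2 B (Finset.mem_of_mem_erase hB) D (Finset.mem_of_mem_erase hD) with h | h
  · exact main B hB D hD hBD heq h
  · exact main D hD B hB hBD.symm heq.symm h
end

section
/- Fix integers t ≥ 2 and n ≥ 1. Let A = I_t (the t×t identity matrix), B = −I_t, let D be the (t−1)×t integer matrix with D_{i,i} = 1, D_{i,i+1} = −1 and all other entries 0, and let C be the (t−1)×t integer matrix with C_{i,i} = −1 and all other entries 0. Let H be the 4-block n-fold matrix built from A, B, C, D. Then every nonzero y ∈ Z^{t + n·t} with H·y = 0 satisfies ‖y‖_∞ ≥ n^{t−1}. -/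
/-- For the concrete matrices `A = I`, `B = -I`, `D` (difference matrix) and `C`
(negative partial identity), every nonzero integer kernel element of the associated
4-block n-fold matrix has `ℓ∞`-norm at least `n^{t-1}`. -/
theorem kernel_lower_bound_fourBlock (t n : ℕ) (ht : 2 ≤ t) (hn : 1 ≤ n)
    (D : Matrix (Fin (t - 1)) (Fin t) ℤ)
    (hD : ∀ i j, D i j = if (j : ℕ) = (i : ℕ) then 1
      else if (j : ℕ) = (i : ℕ) + 1 then -1 else 0)
    (C : Matrix (Fin (t - 1)) (Fin t) ℤ)
    (hC : ∀ i j, C i j = if (j : ℕ) = (i : ℕ) then -1 else 0)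
    (y : Fin t ⊕ Fin n × Fin t → ℤ)
    (hker : (fourBlock n t t (t - 1) t (1 : Matrix (Fin t) (Fin t) ℤ)
      (-1 : Matrix (Fin t) (Fin t) ℤ) C D).mulVec y = 0)
    (hy : y ≠ 0) :
    ∃ i, (n : ℤ) ^ (t - 1) ≤ |y i| := by
  have hblk : ∀ k i, y (Sum.inr (k, i)) = y (Sum.inl i) := by
    intro k i
    have h := congrFun hker (Sum.inr (k, i))
    simp [Matrix.mulVec, dotProduct, fourBlock, Fintype.sum_prod_type, Matrix.one_apply,
      Matrix.neg_apply, ite_mul, Finset.sum_ite_eq] at h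
    have h2 : ∑ l : Fin n, ∑ j : Fin t, (if k = l then if i = j then (1 : ℤ) else 0 else 0) *
        y (Sum.inr (l, j)) = y (Sum.inr (k, i)) := by
      rw [Finset.sum_eq_single k]
      · simp
      · intro b _ hb
        simp [Ne.symm hb]
      · simp
    simp [ite_mul] at h2
    linarith
  have hrec : ∀ (m : ℕ) (h1 : m + 1 < t),
      ((n : ℤ) - 1) * y (Sum.inl ⟨m, by omega⟩) = n * y (Sum.inl ⟨m + 1, h1⟩) := by
    intro m h1
    have h := congrFun hker (Sum.inl ⟨m, by omega⟩)
    have hCs : ∑ j, C ⟨m, by omega⟩ j * y (Sum.inl j) = - y (Sum.inl ⟨m, by omega⟩) := by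
      rw [Finset.sum_eq_single (⟨m, by omega⟩ : Fin t)]
      · simp [hC]
      · intro b _ hb
        have : (b : ℕ) ≠ m := fun e => hb (Fin.ext e)
        simp [hC, this]
      · simp
    have hDs : ∑ j, D ⟨m, by omega⟩ j * y (Sum.inl j) =
        y (Sum.inl ⟨m, by omega⟩) - y (Sum.inl ⟨m + 1, h1⟩) := by
      rw [Finset.sum_eq_add (⟨m, by omega⟩ : Fin t) ⟨m + 1, h1⟩]
      · simp [hD]; ring
      · simp
      · rintro b _ ⟨hb, hb'⟩
        have e1 : (b : ℕ) ≠ m := fun e => hb (Fin.ext e)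
        have e2 : (b : ℕ) ≠ m + 1 := fun e => hb' (Fin.ext e)
        simp [hD, e1, e2]
      · simp
      · simp
    simp only [Matrix.mulVec, dotProduct, fourBlock, Matrix.of_apply, Fintype.sum_sum_type,
      Fintype.sum_prod_type, hblk, Pi.zero_apply] at h
    rw [hCs, hDs] at h
    simp at h
    linarith
  have hpow : ∀ (m : ℕ) (h1 : m < t),
      ((n : ℤ) - 1) ^ m * y (Sum.inl ⟨0, by omega⟩) = n ^ m * y (Sum.inl ⟨m, h1⟩) := by
    intro m
    induction m with
    | zero => intro h1; simp
    | succ m ih =>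
      intro h1
      have a := ih (by omega)
      have b := hrec m h1
      rw [pow_succ, pow_succ]
      linear_combination ((n : ℤ) - 1) * a + (n : ℤ) ^ m * b
  have hn0 : (n : ℤ) ≠ 0 := by exact_mod_cast (by omega : n ≠ 0)
  have hx0 : y (Sum.inl ⟨0, by omega⟩) ≠ 0 := by
    intro h0
    have hz : ∀ j, y (Sum.inl j) = 0 := by
      intro j
      have := hpow j j.2
      rw [h0, mul_zero] at this
      exact (mul_eq_zero.mp this.symm).resolve_left (pow_ne_zero _ hn0)
    apply hy
    funext c
    rcases c with j | ⟨k, j⟩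
    · exact hz j
    · rw [hblk]; exact hz j
  refine ⟨Sum.inl ⟨0, by omega⟩, Int.le_of_dvd (abs_pos.mpr hx0) ?_⟩
  rw [dvd_abs]
  have hcop : IsCoprime ((n : ℤ) ^ (t - 1)) (((n : ℤ) - 1) ^ (t - 1)) :=
    IsCoprime.pow ⟨1, -1, by ring⟩
  exact hcop.dvd_of_dvd_mul_left ⟨_, hpow (t - 1) (by omega)⟩
end

section
/- For all positive integers s_A, t_A, s_D, t_B and Δ there exists a constant ξ, depending only on s_A, t_A, s_D, t_B and Δ, with the following property. For every n ≥ 1, all integer matrices A (s_A×t_A), B (s_A×t_B), D (s_D×t_A) with entries of absolute value at most Δ, and every g ∈ Z^{t_B + n·t_A} with H_0·g = 0 (where H_0 is the 3-block n-fold matrix built from A, B, D), there exists a finite sequence of vectors e_1, e_2, …, e_k ∈ Z^{t_B + n·t_A} such that H_0·e_h = 0, ‖e_h‖_∞ ≤ ξ, e_h^0 ⊑ g^0 for every h, and g = e_1 + e_2 + … + e_k. -/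
/-- The 3-block n-fold matrix built from `A, B, D` (a 4-block n-fold matrix with `C = 0`). -/
def threeBlock (n sA tA sD tB : ℕ)
    (A : Matrix (Fin sA) (Fin tA) ℤ) (B : Matrix (Fin sA) (Fin tB) ℤ)
    (D : Matrix (Fin sD) (Fin tA) ℤ) :
    Matrix (Fin sD ⊕ Fin n × Fin sA) (Fin tB ⊕ Fin n × Fin tA) ℤ :=
  Matrix.of fun r c =>
    match r, c with
    | Sum.inl _, Sum.inl _ => 0
    | Sum.inl i, Sum.inr (_, j) => D i j
    | Sum.inr (_, i), Sum.inl j => B i j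
    | Sum.inr (k, i), Sum.inr (l, j) => if k = l then A i j else 0

theorem hd_bdd {m : ℕ} (S : Set (Fin m → ℤ)) (hS : S.Finite) :
    ∃ c : ℕ, ∀ v ∈ S, ∀ i, |v i| ≤ (c : ℤ) := by
  refine ⟨∑ v ∈ hS.toFinset, ∑ i, (v i).natAbs, fun v hv i => ?_⟩
  have h1 : ∑ i, (v i).natAbs ≤ ∑ v ∈ hS.toFinset, ∑ i, (v i).natAbs :=
    Finset.single_le_sum (f := fun v : Fin m → ℤ => ∑ i, (v i).natAbs)
      (fun _ _ => Nat.zero_le _) (hS.mem_toFinset.2 hv)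
  have h2 : (v i).natAbs ≤ ∑ i, (v i).natAbs :=
    Finset.single_le_sum (f := fun i => (v i).natAbs)
      (fun _ _ => Nat.zero_le _) (Finset.mem_univ i)
  have h3 := h2.trans h1
  rw [Int.abs_eq_natAbs]
  exact_mod_cast h3

theorem hd_torsion {V : Type*} [AddCommGroup V] [IsNoetherian ℤ V]
    (M : Submodule ℤ V) :
    ∃ T : ℕ, 2 ≤ T ∧ ∀ v : V, ∀ n : ℕ, 1 ≤ n → (n : ℤ) • v ∈ M → (T : ℤ) • v ∈ M := by
  let N : Submodule ℤ V :=
    { carrier := {v | ∃ n : ℕ, 1 ≤ n ∧ (n : ℤ) • v ∈ M}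
      zero_mem' := ⟨1, le_rfl, by simp⟩
      add_mem' := by
        rintro u v ⟨n, hn, hu⟩ ⟨m, hm, hv⟩
        refine ⟨n * m, Nat.mul_pos hn hm, ?_⟩
        have : ((n * m : ℕ) : ℤ) • (u + v) = (m : ℤ) • ((n : ℤ) • u) + (n : ℤ) • ((m : ℤ) • v) := by
          push_cast; module
        rw [this]
        exact M.add_mem (M.smul_mem _ hu) (M.smul_mem _ hv)
      smul_mem' := by
        rintro c v ⟨n, hn, hv⟩
        refine ⟨n, hn, ?_⟩
        rw [smul_comm]
        exact M.smul_mem _ hv }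
  obtain ⟨S, hS⟩ := IsNoetherian.noetherian N
  have hSN : ∀ v ∈ S, ∃ n : ℕ, 1 ≤ n ∧ (n : ℤ) • v ∈ M := by
    intro v hv
    have : v ∈ N := hS ▸ Submodule.subset_span hv
    exact this
  choose! f hf1 hf2 using hSN
  refine ⟨2 * ∏ v ∈ S, f v, ?_, ?_⟩
  · have : 0 < ∏ v ∈ S, f v := Finset.prod_pos hf1
    omega
  · intro v n hn hv
    have hvN : v ∈ N := ⟨n, hn, hv⟩
    rw [← hS] at hvN
    clear hv hn
    induction hvN using Submodule.span_induction with
    | mem x hx =>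
      obtain ⟨c, hc⟩ := Finset.dvd_prod_of_mem f hx
      rw [hc]
      have : ((2 * (f x * c) : ℕ) : ℤ) • x = (2 * c : ℤ) • ((f x : ℤ) • x) := by
        push_cast; module
      rw [this]
      exact M.smul_mem _ (hf2 x hx)
    | zero => rw [smul_zero]; exact M.zero_mem
    | add x y _ _ hx hy => rw [smul_add]; exact M.add_mem hx hy
    | smul c x _ hx => rw [smul_comm]; exact M.smul_mem _ hx

/-- conformal order on integer vectors -/
def hdSq {t : ℕ} (x y : Fin t → ℤ) : Prop := ∀ j, |x j| ≤ |y j| ∧ 0 ≤ x j * y j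

def hdPhi {t : ℕ} (x : Fin t → ℤ) : Fin t ⊕ Fin t → ℕ :=
  Sum.elim (fun j => (x j).toNat) (fun j => (-(x j)).toNat)

theorem hdPhi_inj {t : ℕ} : Function.Injective (hdPhi (t := t)) := by
  intro x y h
  funext j
  have h1 := congrFun h (Sum.inl j)
  have h2 := congrFun h (Sum.inr j)
  simp only [hdPhi, Sum.elim_inl, Sum.elim_inr] at h1 h2
  omega

theorem hd_sq_one (x y : ℤ) :
    (|x| ≤ |y| ∧ 0 ≤ x * y) ↔ ((0 ≤ x ∧ x ≤ y) ∨ (x ≤ 0 ∧ y ≤ x)) := by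
  constructor
  · rintro ⟨h1, h2⟩
    rcases le_total 0 x with hx | hx <;> rcases le_total 0 y with hy | hy
    · rw [abs_of_nonneg hx, abs_of_nonneg hy] at h1; omega
    · rw [abs_of_nonneg hx, abs_of_nonpos hy] at h1
      have : x = 0 ∨ y = 0 := by
        rw [← mul_eq_zero]; nlinarith
      omega
    · rw [abs_of_nonpos hx, abs_of_nonneg hy] at h1
      have : x = 0 ∨ y = 0 := by
        rw [← mul_eq_zero]; nlinarith
      omega
    · rw [abs_of_nonpos hx, abs_of_nonpos hy] at h1; omega
  · rintro (⟨h1, h2⟩ | ⟨h1, h2⟩)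
    · rw [abs_of_nonneg h1, abs_of_nonneg (h1.trans h2)]; exact ⟨h2, by nlinarith⟩
    · rw [abs_of_nonpos h1, abs_of_nonpos (h2.trans h1)]; exact ⟨by omega, by nlinarith⟩

theorem hdPhi_le {t : ℕ} (x y : Fin t → ℤ) (h : hdPhi x ≤ hdPhi y) : hdSq x y := by
  intro j
  rw [hd_sq_one]
  have h1 := h (Sum.inl j)
  have h2 := h (Sum.inr j)
  simp only [hdPhi, Sum.elim_inl, Sum.elim_inr] at h1 h2
  omega

theorem hdSq_sub {t : ℕ} (x y : Fin t → ℤ) (h : hdSq x y) : hdSq (y - x) y := by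
  intro j
  have := h j
  rw [hd_sq_one] at this ⊢
  simp only [Pi.sub_apply]
  omega

theorem hdSq_trans {t : ℕ} (x y z : Fin t → ℤ) (h : hdSq x y) (h' : hdSq y z) : hdSq x z := by
  intro j
  have := h j
  have := h' j
  rw [hd_sq_one] at *
  omega

theorem hd_graver {t : ℕ} (P : AddSubgroup (Fin t → ℤ)) :
    ∃ F : Set (Fin t → ℤ), F.Finite ∧ F ⊆ P ∧
      ∀ x ∈ P, x ∈ AddSubmonoid.closure {f | f ∈ F ∧ hdSq f x} := by
  let Q : (Fin t ⊕ Fin t → ℕ) → Prop := fun u => ∃ x ∈ P, x ≠ 0 ∧ hdPhi x = u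
  refine ⟨hdPhi ⁻¹' {u | Minimal Q u}, ?_, ?_, ?_⟩
  · apply Set.Finite.preimage hdPhi_inj.injOn
    apply WellQuasiOrderedLE.finite_of_isAntichain
    exact setOfPred_minimal_antichain _
  · rintro x hx
    obtain ⟨y, hy, -, hyx⟩ := hx.prop
    rw [← hdPhi_inj hyx]; exact hy
  · intro x hx
    induction hN : ∑ j, (x j).natAbs using Nat.strong_induction_on generalizing x with
    | _ N ih =>
    by_cases hx0 : x = 0
    · rw [hx0]; exact zero_mem _
    obtain ⟨u, hu, hmin⟩ := exists_minimal_le_of_wellFoundedLT Q (hdPhi x) ⟨x, hx, hx0, rfl⟩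
    obtain ⟨f, hfP, hf0, rfl⟩ := hmin.prop
    have hsq := hdPhi_le _ _ hu
    have hsq' := hdSq_sub _ _ hsq
    have key := ih (∑ j, ((x - f) j).natAbs) ?_ (x - f) (P.sub_mem hx hfP) rfl
    · have h1 : x - f ∈ AddSubmonoid.closure {f | f ∈ hdPhi ⁻¹' {u | Minimal Q u} ∧ hdSq f x} := by
        refine AddSubmonoid.closure_mono ?_ key
        rintro w ⟨hw, hw'⟩
        exact ⟨hw, hdSq_trans _ _ _ hw' hsq'⟩
      have h2 : f ∈ AddSubmonoid.closure {f | f ∈ hdPhi ⁻¹' {u | Minimal Q u} ∧ hdSq f x} :=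
        AddSubmonoid.subset_closure ⟨hmin, hsq⟩
      have := add_mem h1 h2
      simpa using this
    · rw [← hN]
      obtain ⟨j, hj⟩ : ∃ j, f j ≠ 0 := by
        by_contra! h
        exact hf0 (funext h)
      apply Finset.sum_lt_sum
      · intro i _
        have := hsq i
        rw [hd_sq_one] at this
        simp only [Pi.sub_apply]
        omega
      · refine ⟨j, Finset.mem_univ _, ?_⟩
        have := hsq j
        rw [hd_sq_one] at this
        simp only [Pi.sub_apply]
        omega

theorem hd_map_mem {V E : Type*} [AddCommGroup V] [AddCommGroup E]
    (C : AddSubmonoid E) (φ : V →+ E) (S : Set V)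
    (h : ∀ v ∈ S, φ v ∈ C ∧ -φ v ∈ C) (v : V) (hv : v ∈ Submodule.span ℤ S) : φ v ∈ C := by
  have : φ v ∈ C ∧ -φ v ∈ C := by
    have hv' : v ∈ AddSubgroup.closure S := by
      rw [← Submodule.span_int_eq_addSubgroupClosure]; exact hv
    induction hv' using AddSubgroup.closure_induction with
    | mem x hx => exact h x hx
    | zero => simp
    | add x y hx hy h1 h2 =>
      have h1 := h1 (by rw [← Submodule.span_int_eq_addSubgroupClosure] at hx; exact hx)
      have h2 := h2 (by rw [← Submodule.span_int_eq_addSubgroupClosure] at hy; exact hy)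
      rw [map_add, neg_add]
      exact ⟨add_mem h1.1 h2.1, add_mem h1.2 h2.2⟩
    | neg x hx h1 =>
      have h1 := h1 (by rw [← Submodule.span_int_eq_addSubgroupClosure] at hx; exact hx)
      rw [map_neg, neg_neg]
      exact ⟨h1.2, h1.1⟩
  exact this.1

/-- sum of the distribution of correction vectors -/
theorem hd_distrib {V : Type*} [AddCommGroup V] (n q : ℕ) (hq : q < n) (y w z : V) :
    ∑ i : Fin n, (y - (if i.val < q then w else if i.val = q then z else 0))
      = (n : ℤ) • y - (q : ℤ) • w - z := by
  rw [Fin.sum_univ_eq_sum_range (fun i => y - (if i < q then w else if i = q then z else 0)) n]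
  obtain ⟨m, rfl⟩ : ∃ m, n = (q + 1) + m := ⟨n - (q + 1), by omega⟩
  rw [Finset.sum_sub_distrib, Finset.sum_range_add (fun i => if i < q then w else if i = q then z else 0) (q+1) m,
    Finset.sum_range_succ (fun i => if i < q then w else if i = q then z else 0)]
  have h1 : ∑ x ∈ Finset.range q, (if x < q then w else if x = q then z else 0) = q • w := by
    rw [Finset.sum_congr rfl (g := fun _ => w)]
    · simp
    · intro i hi
      rw [if_pos (Finset.mem_range.1 hi)]
  have h2 : ∑ x ∈ Finset.range m, (if q + 1 + x < q then w else if q + 1 + x = q then z else 0) = 0 := by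
    apply Finset.sum_eq_zero
    intro i _
    rw [if_neg (by omega), if_neg (by omega)]
  rw [h1, h2, Finset.sum_const, Finset.card_range, natCast_zsmul, natCast_zsmul]
  simp only [lt_irrefl, if_false, if_true, add_zero]
  abel

theorem hd_core {sA tA sD tB : ℕ} (a : (Fin tA → ℤ) →ₗ[ℤ] (Fin sA → ℤ))
    (b : (Fin tB → ℤ) →ₗ[ℤ] (Fin sA → ℤ)) (d : (Fin tA → ℤ) →ₗ[ℤ] (Fin sD → ℤ)) :
    ∃ ξ : ℕ, ∀ n : ℕ, 1 ≤ n → ∀ (x : Fin tB → ℤ) (y : Fin n → Fin tA → ℤ),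
      (∀ k, b x + a (y k) = 0) → ∑ k, d (y k) = 0 →
      (x, y) ∈ AddSubmonoid.closure {e : (Fin tB → ℤ) × (Fin n → Fin tA → ℤ) |
        (∀ k, b e.1 + a (e.2 k) = 0) ∧ ∑ k, d (e.2 k) = 0 ∧ (∀ j, |e.1 j| ≤ (ξ : ℤ)) ∧
        (∀ k j, |e.2 k j| ≤ (ξ : ℤ)) ∧ hdSq e.1 x} := by
  obtain ⟨T, hT2, hT⟩ := hd_torsion ((LinearMap.ker a).map d)
  obtain ⟨S, hS⟩ := IsNoetherian.noetherian (LinearMap.ker a)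
  obtain ⟨S', hS'⟩ := IsNoetherian.noetherian (LinearMap.ker a ⊓ LinearMap.ker d)
  obtain ⟨c, hc⟩ := hd_bdd (S : Set (Fin tA → ℤ)) S.finite_toSet
  obtain ⟨c', hc'⟩ := hd_bdd (S' : Set (Fin tA → ℤ)) S'.finite_toSet
  let P : ℕ → AddSubgroup (Fin tB → ℤ) := fun r =>
    { carrier := {x | ∃ y w z, b x + a y = 0 ∧ a w = 0 ∧ a z = 0 ∧ (T : ℤ) • d y = d w ∧
        (r : ℤ) • d y = d z}
      zero_mem' := ⟨0, 0, 0, by simp⟩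
      add_mem' := by
        rintro x x' ⟨y, w, z, h1, h2, h3, h4, h5⟩ ⟨y', w', z', h1', h2', h3', h4', h5'⟩
        refine ⟨y + y', w + w', z + z', ?_, by simp [h2, h2'], by simp [h3, h3'],
          by simp [h4, h4'], by simp [h5, h5']⟩
        rw [map_add, map_add, add_add_add_comm, h1, h1', add_zero]
      neg_mem' := by
        rintro x ⟨y, w, z, h1, h2, h3, h4, h5⟩
        refine ⟨-y, -w, -z, ?_, by simp [h2], by simp [h3], by simp [h4], by simp [h5]⟩
        rw [map_neg, map_neg, ← neg_add, h1, neg_zero] }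
  have hP : ∀ r, ∀ x ∈ P r, ∃ y w z, b x + a y = 0 ∧ a w = 0 ∧ a z = 0 ∧ (T : ℤ) • d y = d w ∧
        (r : ℤ) • d y = d z := fun r x hx => hx
  choose! Y W Z h1 h2 h3 h4 h5 using hP
  choose F hFfin hFP hFx using fun r => hd_graver (P r)
  choose c1 hc1 using fun r => hd_bdd (F r) (hFfin r)
  choose c2 hc2 using fun r => hd_bdd (Y r '' F r) ((hFfin r).image _)
  choose c3 hc3 using fun r => hd_bdd (W r '' F r) ((hFfin r).image _)
  choose c4 hc4 using fun r => hd_bdd (Z r '' F r) ((hFfin r).image _)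
  let m : ℕ → ℕ := fun r => c1 r + c2 r + c3 r + c4 r
  refine ⟨2 * c + c' + ∑ r ∈ Finset.range T, m r, ?_⟩
  intro n hn x y hk hs
  set ξ := 2 * c + c' + ∑ r ∈ Finset.range T, m r with hξ
  set C := AddSubmonoid.closure {e : (Fin tB → ℤ) × (Fin n → Fin tA → ℤ) |
        (∀ k, b e.1 + a (e.2 k) = 0) ∧ ∑ k, d (e.2 k) = 0 ∧ (∀ j, |e.1 j| ≤ (ξ : ℤ)) ∧
        (∀ k j, |e.2 k j| ≤ (ξ : ℤ)) ∧ hdSq e.1 x} with hC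
  set r := n % T with hr
  set q := n / T with hq
  have hrT : r < T := Nat.mod_lt _ (by omega)
  have hqn : q < n := Nat.div_lt_self (by omega) (by omega)
  have hnqr : (n : ℤ) = q * T + r := by
    have := Nat.div_add_mod n T
    rw [mul_comm] at this
    exact_mod_cast this.symm
  have hm : m r ≤ ∑ r ∈ Finset.range T, m r :=
    Finset.single_le_sum (f := m) (fun _ _ => Nat.zero_le _) (Finset.mem_range.2 hrT)
  have hmξ : (c1 r : ℤ) + c2 r + c3 r + c4 r ≤ ξ := by
    have : c1 r + c2 r + c3 r + c4 r ≤ ξ := by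
      change m r ≤ ξ
      omega
    exact_mod_cast this
  have hcξ : 2 * (c : ℤ) + c' ≤ ξ := by
    have : 2 * c + c' ≤ ξ := by omega
    exact_mod_cast this
  let k0 : Fin n := ⟨0, hn⟩
  -- x is in P r
  have hxP : x ∈ P r := by
    have hz' : (n : ℤ) • d (y k0) = d (∑ k, (y k0 - y k)) := by
      rw [map_sum]
      simp [hs]
    have haz' : a (∑ k, (y k0 - y k)) = 0 := by
      rw [map_sum]
      apply Finset.sum_eq_zero
      intro k _
      rw [map_sub, sub_eq_zero]
      exact add_left_cancel ((hk k0).trans (hk k).symm)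
    obtain ⟨w, hw, hw'⟩ := hT (d (y k0)) n hn ⟨_, haz', hz'.symm⟩
    have hw : a w = 0 := hw
    refine ⟨y k0, w, ∑ k, (y k0 - y k) - (q : ℤ) • w, hk k0, hw, ?_, hw'.symm, ?_⟩
    · rw [map_sub, haz', map_smul, hw, smul_zero, sub_zero]
    · rw [map_sub, ← hz', map_smul, hw', hnqr]
      module
  -- first part
  have hfirst : ∀ x' ∈ AddSubmonoid.closure {f | f ∈ F r ∧ hdSq f x},
      ∃ e ∈ C, e.1 = x' ∧ (∀ k, b e.1 + a (e.2 k) = 0) ∧ ∑ k, d (e.2 k) = 0 := by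
    intro x' hx'
    induction hx' using AddSubmonoid.closure_induction with
    | zero => exact ⟨0, zero_mem _, rfl, by simp, by simp⟩
    | add u v _ _ hu hv =>
      obtain ⟨e, heC, he1, he2, he3⟩ := hu
      obtain ⟨e', heC', he1', he2', he3'⟩ := hv
      refine ⟨e + e', add_mem heC heC', by rw [Prod.fst_add, he1, he1'], ?_, ?_⟩
      · intro k
        rw [Prod.fst_add, Prod.snd_add, Pi.add_apply, map_add, map_add, add_add_add_comm,
          he2, he2', add_zero]
      · simp only [Prod.snd_add, Pi.add_apply, map_add, Finset.sum_add_distrib, he3, he3', add_zero]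
    | mem f hf =>
      obtain ⟨hfF, hfx⟩ := hf
      have hfP := hFP r hfF
      have g1 : ∀ k : Fin n, b f + a (Y r f - (if k.val < q then W r f else
          if k.val = q then Z r f else 0)) = 0 := by
        intro k
        have : a (if k.val < q then W r f else if k.val = q then Z r f else 0) = 0 := by
          split_ifs
          · exact h2 r f hfP
          · exact h3 r f hfP
          · simp
        rw [map_sub, this, sub_zero]
        exact h1 r f hfP
      have g2 : ∑ k : Fin n, d (Y r f - (if k.val < q then W r f else
          if k.val = q then Z r f else 0)) = 0 := by
        rw [← map_sum, hd_distrib n q hqn, map_sub, map_sub, map_smul, map_smul, ← h4 r f hfP,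
          ← h5 r f hfP, hnqr]
        module
      refine ⟨(f, fun k => Y r f - (if k.val < q then W r f else
          if k.val = q then Z r f else 0)), ?_, rfl, g1, g2⟩
      apply AddSubmonoid.subset_closure
      refine ⟨g1, g2, ?_, ?_, hfx⟩
      · intro j
        have := hc1 r f hfF j
        dsimp only
        omega
      · intro k j
        have e2 := hc2 r _ (Set.mem_image_of_mem _ hfF) j
        have e3 := hc3 r _ (Set.mem_image_of_mem _ hfF) j
        have e4 := hc4 r _ (Set.mem_image_of_mem _ hfF) j
        dsimp only
        rw [abs_le] at *
        split_ifs <;> simp only [Pi.sub_apply, Pi.zero_apply] <;> omega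
  obtain ⟨e, heC, he1, he2, he3⟩ := hfirst x (hFx r x hxP)
  -- remainder
  set u : Fin n → Fin tA → ℤ := fun k => y k - e.2 k with hu
  have hua : ∀ k, a (u k) = 0 := by
    intro k
    rw [hu, map_sub, sub_eq_zero]
    have := he2 k
    rw [he1] at this
    exact add_left_cancel ((hk k).trans this.symm)
  have hud : ∑ k, d (u k) = 0 := by
    simp only [hu, map_sub, Finset.sum_sub_distrib, hs, he3, sub_zero]
  have hxy : (x, y) = e + (0, u) := by
    ext1
    · simp [he1]
    · funext k
      simp [hu]
  let ι : Fin n → (Fin tA → ℤ) →+ (Fin tB → ℤ) × (Fin n → Fin tA → ℤ) := fun k =>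
    (AddMonoidHom.inr _ _).comp (AddMonoidHom.single (fun _ : Fin n => Fin tA → ℤ) k)
  have hι1 : ∀ k v, (ι k v).1 = 0 := fun k v => rfl
  have hι2 : ∀ k v, (ι k v).2 = Pi.single k v := fun k v => rfl
  have hsing : ∀ k l (v : Fin tA → ℤ), (Pi.single k v : Fin n → Fin tA → ℤ) l = v ∨
      (Pi.single k v : Fin n → Fin tA → ℤ) l = 0 := by
    intro k l v
    by_cases h : l = k
    · subst h; simp
    · right; simp [h]
  have hsingd : ∀ k (v : Fin tA → ℤ), ∑ l, d ((Pi.single k v : Fin n → Fin tA → ℤ) l) = d v := by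
    intro k v
    rw [← map_sum, Finset.sum_pi_single' ]
    simp
  have hsq0 : hdSq (0 : Fin tB → ℤ) x := fun j => by simp
  have hmemC : ∀ w : Fin n → Fin tA → ℤ, (∀ k, a (w k) = 0) → ∑ k, d (w k) = 0 →
      (∀ k j, |w k j| ≤ (ξ : ℤ)) → ((0, w) : (Fin tB → ℤ) × (Fin n → Fin tA → ℤ)) ∈ C ∧
      -((0, w) : (Fin tB → ℤ) × (Fin n → Fin tA → ℤ)) ∈ C := by
    intro w w1 w2 w3
    constructor
    · apply AddSubmonoid.subset_closure
      refine ⟨by simpa using w1, w2, by simp, w3, hsq0⟩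
    · apply AddSubmonoid.subset_closure
      refine ⟨by simpa using w1, by simpa using w2, by simp, by simpa using w3, by simpa using hsq0⟩
  have hA : ∀ k, ∀ v, a v = 0 → (ι k - ι k0) v ∈ C := by
    intro k v hv
    refine hd_map_mem C (ι k - ι k0) S ?_ v (by rw [hS]; exact hv)
    intro v hv
    have hav : a v = 0 := by
      have : v ∈ LinearMap.ker a := hS ▸ Submodule.subset_span hv
      exact this
    have heq : (ι k - ι k0) v = (0, Pi.single k v - Pi.single k0 v) := by
      rw [AddMonoidHom.sub_apply]
      ext1
      · simp [hι1]
      · simp [hι2]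
    rw [heq]
    apply hmemC
    · intro l
      rw [Pi.sub_apply, map_sub]
      rcases hsing k l v with h | h <;> rcases hsing k0 l v with h' | h' <;> simp [h, h', hav]
    · simp only [Pi.sub_apply, map_sub, Finset.sum_sub_distrib, hsingd, sub_self]
    · intro l j
      have := hc v hv j
      rw [Pi.sub_apply, Pi.sub_apply]
      rw [abs_le] at *
      rcases hsing k l v with h | h <;> rcases hsing k0 l v with h' | h' <;> rw [h, h'] <;>
        (try simp only [Pi.zero_apply]) <;> omega
  have hB : ∀ v, a v = 0 → d v = 0 → ι k0 v ∈ C := by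
    intro v hv hv'
    refine hd_map_mem C (ι k0) S' ?_ v (by rw [hS']; exact ⟨hv, hv'⟩)
    intro v hv
    have hav : v ∈ LinearMap.ker a ⊓ LinearMap.ker d := hS' ▸ Submodule.subset_span hv
    obtain ⟨hav, hdv⟩ := hav
    have hav : a v = 0 := hav
    have hdv : d v = 0 := hdv
    change (0, Pi.single k0 v) ∈ C ∧ -(0, Pi.single k0 v) ∈ C
    apply hmemC
    · intro l
      rcases hsing k0 l v with h | h <;> simp [h, hav]
    · rw [hsingd, hdv]
    · intro l j
      have := hc' v hv j
      rw [abs_le] at *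
      rcases hsing k0 l v with h | h <;> rw [h] <;>
        (try simp only [Pi.zero_apply]) <;> omega
  have hu0 : ((0, u) : (Fin tB → ℤ) × (Fin n → Fin tA → ℤ)) = ∑ k, ι k (u k) := by
    ext1
    · rw [Prod.fst_sum]; simp [hι1]
    · rw [Prod.snd_sum]
      simp only [hι2]
      exact (Finset.univ_sum_single u).symm
  have hu1 : ∑ k, ι k (u k) = ∑ k, (ι k - ι k0) (u k) + ι k0 (∑ k, u k) := by
    simp only [AddMonoidHom.sub_apply, Finset.sum_sub_distrib, map_sum, sub_add_cancel]
  rw [hxy]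
  refine add_mem heC ?_
  rw [hu0, hu1]
  refine add_mem (sum_mem fun k _ => hA k _ (hua k)) (hB _ ?_ ?_)
  · rw [map_sum]; exact Finset.sum_eq_zero fun k _ => hua k
  · rw [map_sum]; exact hud

theorem hd_ker_iff {n sA tA sD tB : ℕ}
    (A : Matrix (Fin sA) (Fin tA) ℤ) (B : Matrix (Fin sA) (Fin tB) ℤ)
    (D : Matrix (Fin sD) (Fin tA) ℤ) (g : (Fin tB ⊕ Fin n × Fin tA) → ℤ) :
    (threeBlock n sA tA sD tB A B D).mulVec g = 0 ↔
      (∀ k, B.mulVecLin (fun j => g (Sum.inl j)) + A.mulVecLin (fun j => g (Sum.inr (k, j))) = 0) ∧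
      ∑ k, D.mulVecLin (fun j => g (Sum.inr (k, j))) = 0 := by
  have e1 : ∀ i, (threeBlock n sA tA sD tB A B D).mulVec g (Sum.inl i) =
      (∑ k, D.mulVecLin (fun j => g (Sum.inr (k, j)))) i := by
    intro i
    simp [Matrix.mulVec, dotProduct, threeBlock, Fintype.sum_prod_type, Finset.sum_apply]
  have e2 : ∀ k i, (threeBlock n sA tA sD tB A B D).mulVec g (Sum.inr (k, i)) =
      (B.mulVecLin (fun j => g (Sum.inl j)) + A.mulVecLin (fun j => g (Sum.inr (k, j)))) i := by
    intro k i
    simp only [Matrix.mulVec, dotProduct, threeBlock, Fintype.sum_sum_type, Fintype.sum_prod_type,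
      Matrix.of_apply, Matrix.mulVecLin_apply, Pi.add_apply, ite_mul, zero_mul]
    congr 1
    rw [Finset.sum_comm]
    simp
  constructor
  · intro h
    constructor
    · intro k
      funext i
      rw [← e2, h]; rfl
    · funext i
      rw [← e1, h]; rfl
  · rintro ⟨h1, h2⟩
    funext i
    rcases i with i | ⟨k, i⟩
    · rw [e1, h2]; rfl
    · rw [e2, h1]; rfl

theorem hd_mat_finite (s t Δ : ℕ) :
    {A : Matrix (Fin s) (Fin t) ℤ | ∀ i j, |A i j| ≤ (Δ : ℤ)}.Finite := by
  have : (Set.Icc (fun _ _ => -(Δ : ℤ)) (fun _ _ => (Δ : ℤ)) : Set (Fin s → Fin t → ℤ)).Finite :=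
    Set.finite_Icc _ _
  refine this.subset ?_
  intro A hA
  exact ⟨fun i j => (abs_le.1 (hA i j)).1, fun i j => (abs_le.1 (hA i j)).2⟩




/-- Any integer kernel element `g` of a 3-block n-fold matrix decomposes as a finite sum
of kernel elements `e_h` whose `ℓ∞`-norm is bounded by a constant `ξ` depending only on
the small matrices, and whose 0-th brick is `⊑` the 0-th brick of `g`. -/
theorem hilbert_decomposition_threeBlock
    (sA tA sD tB Δ : ℕ) (hsA : 0 < sA) (htA : 0 < tA) (hsD : 0 < sD)
    (htB : 0 < tB) (hΔ : 0 < Δ) :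
    ∃ ξ : ℕ, ∀ n : ℕ, 1 ≤ n →
      ∀ (A : Matrix (Fin sA) (Fin tA) ℤ) (B : Matrix (Fin sA) (Fin tB) ℤ)
        (D : Matrix (Fin sD) (Fin tA) ℤ),
      (∀ i j, |A i j| ≤ (Δ : ℤ)) → (∀ i j, |B i j| ≤ (Δ : ℤ)) →
      (∀ i j, |D i j| ≤ (Δ : ℤ)) →
      ∀ g : (Fin tB ⊕ Fin n × Fin tA) → ℤ,
        (threeBlock n sA tA sD tB A B D).mulVec g = 0 →
        ∃ (k : ℕ) (e : Fin k → (Fin tB ⊕ Fin n × Fin tA) → ℤ),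
          (∀ h, (threeBlock n sA tA sD tB A B D).mulVec (e h) = 0) ∧
          (∀ h i, |e h i| ≤ (ξ : ℤ)) ∧
          (∀ h, ∀ j : Fin tB, |e h (Sum.inl j)| ≤ |g (Sum.inl j)| ∧
            0 ≤ e h (Sum.inl j) * g (Sum.inl j)) ∧
          g = ∑ h, e h := by
  choose ξ hξ using fun p : Matrix (Fin sA) (Fin tA) ℤ × Matrix (Fin sA) (Fin tB) ℤ ×
      Matrix (Fin sD) (Fin tA) ℤ => hd_core p.1.mulVecLin p.2.1.mulVecLin p.2.2.mulVecLin
  have hfin := (hd_mat_finite sA tA Δ).prod ((hd_mat_finite sA tB Δ).prod (hd_mat_finite sD tA Δ))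
  obtain ⟨X, hX⟩ := (hfin.image ξ).bddAbove
  refine ⟨X, ?_⟩
  intro n hn A B D hA hB hD g hg
  have hle : ξ (A, B, D) ≤ X := hX (Set.mem_image_of_mem _ ⟨hA, hB, hD⟩)
  have hle' : (ξ (A, B, D) : ℤ) ≤ X := by exact_mod_cast hle
  rw [hd_ker_iff] at hg
  have hmem := hξ (A, B, D) n hn (fun j => g (Sum.inl j)) (fun k j => g (Sum.inr (k, j)))
    hg.1 hg.2
  obtain ⟨l, hl, hsum⟩ := AddSubmonoid.exists_list_of_mem_closure hmem
  let ψ : (Fin tB → ℤ) × (Fin n → Fin tA → ℤ) →+ ((Fin tB ⊕ Fin n × Fin tA) → ℤ) :=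
    { toFun := fun e => Sum.elim e.1 (fun p => e.2 p.1 p.2)
      map_zero' := by funext i; rcases i with i | i <;> rfl
      map_add' := by intro e e'; funext i; rcases i with i | i <;> rfl }
  refine ⟨l.length, fun h => ψ (l.get h), ?_, ?_, ?_, ?_⟩
  · intro h
    rw [hd_ker_iff]
    have := hl _ (l.get_mem h)
    exact ⟨this.1, this.2.1⟩
  · intro h i
    have := hl _ (l.get_mem h)
    rcases i with i | ⟨k, i⟩
    · exact (this.2.2.1 i).trans hle'
    · exact (this.2.2.2.1 k i).trans hle'
  · intro h j
    have := hl _ (l.get_mem h)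
    exact this.2.2.2.2 j
  · rw [← map_sum]
    have h1 : ∑ h : Fin l.length, l.get h = l.sum := by
      rw [← List.sum_ofFn, List.ofFn_get]
    rw [h1, hsum]
    funext i
    rcases i with i | i <;> rfl
end

section
/- For all positive integers s_A, t_A, s_D, t_B and Δ there exist constants q' and ξ, depending only on s_A, t_A, s_D, t_B and Δ, with the following property. For every n ≥ 1 and all integer matrices A (s_A×t_A), B (s_A×t_B), D (s_D×t_A) with entries of absolute value at most Δ, there exists a set S = {ē_1, …, ē_{q'}} of vectors in Z^{t_B + n·t_A} with H_0·ē_h = 0 and ‖ē_h‖_∞ ≤ ξ for every h, such that for every y ∈ Z^{t_B + n·t_A} with H_0·y = 0 there exist nonnegative integers α_1, …, α_{q'}, nonnegative integers β_ℓ, and at most 2·n·t_A − 1 vectors d_ℓ = (0, g_ℓ(E)) with g_ℓ(E) in the Graver basis G(E) of the n-fold matrix E built from D and A, such that: α_h = 0 whenever ē_h^0 is not ⊑ y^0; the vectors d_ℓ are pairwise sign-compatible; and y = Σ_h α_h ē_h + Σ_ℓ β_ℓ d_ℓ. -/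
/-- The n-fold matrix built from `D` and `A`. -/
def nfold (n sA tA sD : ℕ)
    (D : Matrix (Fin sD) (Fin tA) ℤ) (A : Matrix (Fin sA) (Fin tA) ℤ) :
    Matrix (Fin sD ⊕ Fin n × Fin sA) (Fin n × Fin tA) ℤ :=
  Matrix.of fun r c =>
    match r, c with
    | Sum.inl i, (_, j) => D i j
    | Sum.inr (k, i), (l, j) => if k = l then A i j else 0


theorem cf_sign {C : Type*} {x z : C → ℤ} (h : conformal x z) (c : C) :
    |x c| = x c * (z c).sign := by
  obtain ⟨h1, h2⟩ := h c
  rcases lt_trichotomy (z c) 0 with hz | hz | hz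
  · rw [Int.sign_eq_neg_one_of_neg hz, abs_of_nonpos]
    · ring
    · by_contra hx
      push Not at hx
      nlinarith
  · rw [hz] at h1
    have : x c = 0 := by simpa using h1
    simp [this]
  · rw [Int.sign_eq_one_of_pos hz, abs_of_nonneg]
    · ring
    · by_contra hx
      push Not at hx
      nlinarith

theorem cf_of_sign {a b : ℤ} (h0 : 0 ≤ a * b.sign) (h1 : a * b.sign ≤ |b|)
    (h2 : b = 0 → a = 0) : |a| ≤ |b| ∧ 0 ≤ a * b := by
  rcases lt_trichotomy b 0 with hz | hz | hz
  · rw [Int.sign_eq_neg_one_of_neg hz] at h0 h1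
    refine ⟨?_, by nlinarith⟩
    rw [abs_of_nonpos (by linarith)]
    linarith
  · simp [hz, h2 hz]
  · rw [Int.sign_eq_one_of_pos hz] at h0 h1
    refine ⟨?_, by nlinarith⟩
    rw [abs_of_nonneg (by linarith)]
    linarith

theorem cf_refl {C : Type*} (x : C → ℤ) : conformal x x :=
  fun _ => ⟨le_rfl, mul_self_nonneg _⟩

theorem cf_trans {C : Type*} {x y z : C → ℤ} (h : conformal x y) (h' : conformal y z) :
    conformal x z := by
  intro c
  refine ⟨(h c).1.trans (h' c).1, ?_⟩
  have h1 := (h c).1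
  have h2 := (h c).2
  have h3 := (h' c).2
  rcases lt_trichotomy (y c) 0 with hz | hz | hz
  · have : x c ≤ 0 := by by_contra hx; push Not at hx; nlinarith
    have : z c ≤ 0 := by by_contra hx; push Not at hx; nlinarith
    nlinarith
  · rw [hz] at h1
    have : x c = 0 := by simpa using h1
    simp [this]
  · have : 0 ≤ x c := by by_contra hx; push Not at hx; nlinarith
    have : 0 ≤ z c := by by_contra hx; push Not at hx; nlinarith
    nlinarith

theorem cf_sub {C : Type*} {x z : C → ℤ} (h : conformal x z) : conformal (z - x) z := by
  intro c
  have h1 := cf_sign h c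
  have h2 : (z c) * (z c).sign = |z c| := (cf_sign (cf_refl z) c).symm
  have h3 := (h c).1
  apply cf_of_sign
  · simp only [Pi.sub_apply, sub_mul]; linarith
  · simp only [Pi.sub_apply, sub_mul]; linarith [abs_nonneg (x c)]
  · intro hz
    rw [hz] at h3
    have : x c = 0 := by simpa using h3
    simp [this, hz]

def wt {C : Type*} [Fintype C] (x : C → ℤ) : ℤ := ∑ c, |x c|

theorem wt_nonneg {C : Type*} [Fintype C] (x : C → ℤ) : 0 ≤ wt x :=
  Finset.sum_nonneg fun _ _ => abs_nonneg _

theorem wt_pos {C : Type*} [Fintype C] {x : C → ℤ} (h : x ≠ 0) : 0 < wt x := by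
  obtain ⟨c, hc⟩ := Function.ne_iff.1 h
  exact Finset.sum_pos' (fun _ _ => abs_nonneg _) ⟨c, Finset.mem_univ _, abs_pos.2 hc⟩

theorem wt_sub {C : Type*} [Fintype C] {x z : C → ℤ} (h : conformal x z) :
    wt z = wt x + wt (z - x) := by
  unfold wt
  rw [← Finset.sum_add_distrib]
  refine Finset.sum_congr rfl fun c _ => ?_
  rw [cf_sign h, cf_sign (cf_sub h), cf_sign (cf_refl z)]
  simp only [Pi.sub_apply]; ring

def minl {C : Type*} (P : AddSubgroup (C → ℤ)) : Set (C → ℤ) :=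
  {g | g ∈ P ∧ g ≠ 0 ∧ ∀ z ∈ P, z ≠ 0 → conformal z g → z = g}

theorem decomp {C : Type*} [Fintype C] (P : AddSubgroup (C → ℤ)) :
    ∀ (N : ℕ) (b : C → ℤ), b ∈ P → wt b ≤ N →
      ∃ μ : (C → ℤ) →₀ ℕ, (∀ g ∈ μ.support, g ∈ minl P ∧ conformal g b) ∧
        b = μ.sum fun g k => (k : ℤ) • g := by
  intro N
  induction N with
  | zero =>
    intro b _ hw
    refine ⟨0, by simp, ?_⟩
    by_contra hb
    have := wt_pos (x := b) (by simpa using hb)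
    push_cast at hw
    linarith
  | succ N ih =>
    intro b hb hw
    by_cases hb0 : b = 0
    · exact ⟨0, by simp, by simpa using hb0⟩
    by_cases hm : b ∈ minl P
    · classical
      refine ⟨Finsupp.single b 1, ?_, by simp⟩
      intro g hg
      have : g = b := by
        have := Finsupp.support_single_subset hg
        simpa using this
      subst this
      exact ⟨hm, cf_refl _⟩
    · have : ∃ z ∈ P, z ≠ 0 ∧ conformal z b ∧ z ≠ b := by
        by_contra hcon
        push Not at hcon
        exact hm ⟨hb, hb0, hcon⟩
      obtain ⟨z, hz, hz0, hzb, hne⟩ := this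
      have h1 := wt_sub hzb
      have h2 := wt_pos hz0
      have h3 := wt_pos (sub_ne_zero.2 (Ne.symm hne))
      push_cast at hw
      obtain ⟨μ, hμ, hμs⟩ := ih z hz (by linarith)
      obtain ⟨ν, hν, hνs⟩ := ih (b - z) (P.sub_mem hb hz) (by linarith)
      classical
      refine ⟨μ + ν, ?_, ?_⟩
      · intro g hg
        rcases Finset.mem_union.1 (Finsupp.support_add hg) with h | h
        · exact ⟨(hμ g h).1, cf_trans (hμ g h).2 hzb⟩
        · exact ⟨(hν g h).1, cf_trans (hν g h).2 (cf_sub hzb)⟩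
      · rw [Finsupp.sum_add_index' (by simp) (by intros; push_cast; rw [add_smul]), ← hμs, ← hνs]
        abel

theorem minl_finite {C : Type*} [Finite C] (P : AddSubgroup (C → ℤ)) : (minl P).Finite := by
  let φ : (C → ℤ) → (C ⊕ C → ℕ) := fun x =>
    Sum.elim (fun c => (x c).toNat) (fun c => (-(x c)).toNat)
  have key : ∀ x y, φ x ≤ φ y → conformal x y := by
    intro x y h c
    have h1 : (x c).toNat ≤ (y c).toNat := h (Sum.inl c)
    have h2 : (-(x c)).toNat ≤ (-(y c)).toNat := h (Sum.inr c)
    rcases le_total 0 (x c) with hx | hx <;> rcases le_total 0 (y c) with hy | hy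
    · exact ⟨by rw [abs_of_nonneg hx, abs_of_nonneg hy]; omega, mul_nonneg hx hy⟩
    · have : x c = 0 := by omega
      simp [this]
    · have : x c = 0 := by omega
      simp [this]
    · exact ⟨by rw [abs_of_nonpos hx, abs_of_nonpos hy]; omega, mul_nonneg_of_nonpos_of_nonpos hx hy⟩
  have hinj : Set.InjOn φ (minl P) := by
    intro x hx y hy h
    exact hy.2.2 x hx.1 hx.2.1 (key x y h.le)
  refine Set.Finite.of_finite_image ?_ hinj
  apply WellQuasiOrderedLE.finite_of_isAntichain
  rintro _ ⟨x, hx, rfl⟩ _ ⟨y, hy, rfl⟩ hne hle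
  exact hne (congrArg φ (hy.2.2 x hx.1 hx.2.1 (key x y hle)))

theorem lp_opt {ι C : Type*} [Fintype ι] [Fintype C] (v : ι → C → ℝ) (s u : C → ℝ)
    (hs : ∀ g, 1 ≤ ∑ c, s c * v g c)
    (hne : ∃ l : ι → ℝ, (∀ g, 0 ≤ l g) ∧ ∀ c, ∑ g, l g * v g c = u c) :
    ∃ l : ι → ℝ, (∀ g, 0 ≤ l g) ∧ (∀ c, ∑ g, l g * v g c = u c) ∧
      (∀ l' : ι → ℝ, (∀ g, 0 ≤ l' g) → (∀ c, ∑ g, l' g * v g c = u c) → ∑ g, l' g ≤ ∑ g, l g) ∧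
      (Finset.univ.filter fun g => l g ≠ 0).card ≤ Fintype.card C := by
  classical
  let K : Set (ι → ℝ) := {l | (∀ g, 0 ≤ l g) ∧ ∀ c, ∑ g, l g * v g c = u c}
  have hswap : ∀ l : ι → ℝ, ∑ g, l g * ∑ c, s c * v g c = ∑ c, s c * ∑ g, l g * v g c := by
    intro l
    simp only [Finset.mul_sum]
    rw [Finset.sum_comm]
    refine Finset.sum_congr rfl fun c _ => Finset.sum_congr rfl fun g _ => by ring
  have hKc : IsClosed K := by
    have : K = (⋂ g, {l : ι → ℝ | 0 ≤ l g}) ∩ ⋂ c, {l : ι → ℝ | ∑ g, l g * v g c = u c} := by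
      ext l; simp [K]
    rw [this]
    refine IsClosed.inter (isClosed_iInter fun g => ?_) (isClosed_iInter fun c => ?_)
    · exact isClosed_le continuous_const (continuous_apply g)
    · exact isClosed_eq (by fun_prop) continuous_const
  have hKb : K ⊆ Set.pi Set.univ fun _ => Set.Icc (0 : ℝ) (∑ c, s c * u c) := by
    rintro l ⟨h0, h1⟩ g _
    refine ⟨h0 g, ?_⟩
    calc l g ≤ ∑ g, l g := Finset.single_le_sum (fun g _ => h0 g) (Finset.mem_univ g)
      _ ≤ ∑ g, l g * ∑ c, s c * v g c :=
        Finset.sum_le_sum fun g _ => le_mul_of_one_le_right (h0 g) (hs g)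
      _ = _ := by rw [hswap]; simp only [h1]
  have hK : IsCompact K :=
    (isCompact_univ_pi fun _ => isCompact_Icc).of_isClosed_subset hKc hKb
  obtain ⟨l0, hl0, hmax⟩ := hK.exists_isMaxOn hne
    (f := fun l : ι → ℝ => ∑ g, l g) (by fun_prop)
  let Q : ℕ → Prop := fun k => ∃ l ∈ K, (∀ l' ∈ K, ∑ g, l' g ≤ ∑ g, l g) ∧
    (Finset.univ.filter fun g => l g ≠ 0).card = k
  have hQ : ∃ k, Q k := ⟨_, l0, hl0, fun l' h => hmax h, rfl⟩
  obtain ⟨l, hlK, hlm, hlc⟩ := Nat.find_spec hQ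
  refine ⟨l, hlK.1, hlK.2, fun l' a b => hlm l' ⟨a, b⟩, ?_⟩
  -- no improving relation
  have key : ∀ d : ι → ℝ, (∀ g, l g = 0 → d g = 0) → (∀ c, ∑ g, d g * v g c = 0) →
      0 ≤ ∑ g, d g → d = 0 := by
    intro d hd0 hdv hds
    by_contra hd
    have hneg : ∃ g, d g < 0 := by
      by_contra hcon
      push Not at hcon
      apply hd
      have h1 := hswap d
      simp only [hdv, mul_zero, Finset.sum_const_zero] at h1
      rw [Finset.sum_eq_zero_iff_of_nonneg
        (fun g _ => mul_nonneg (hcon g) (by linarith [hs g]))] at h1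
      funext g
      have := h1 g (Finset.mem_univ _)
      rcases mul_eq_zero.1 this with h | h
      · exact h
      · linarith [hs g]
    obtain ⟨g0, hg0⟩ := hneg
    obtain ⟨g1, hg1, hmin⟩ := Finset.exists_min_image (Finset.univ.filter fun g => d g < 0)
      (fun g => l g / (- d g)) ⟨g0, by simpa using hg0⟩
    have hg1' : d g1 < 0 := by simpa using hg1
    set t := l g1 / (- d g1) with ht
    have ht0 : 0 ≤ t := div_nonneg (hlK.1 _) (by linarith)
    let l2 : ι → ℝ := fun g => l g + t * d g
    have hl2 : l2 ∈ K := by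
      constructor
      · intro g
        by_cases hg : d g < 0
        · have h1 := hmin g (by simpa using hg)
          rw [le_div_iff₀ (by linarith)] at h1
          simp only [l2]; linarith
        · push Not at hg
          exact add_nonneg (hlK.1 g) (mul_nonneg ht0 hg)
      · intro c
        simp only [l2, add_mul, Finset.sum_add_distrib, hlK.2 c, mul_assoc, ← Finset.mul_sum, hdv]
        simp
    have hsum : ∑ g, l g ≤ ∑ g, l2 g := by
      simp only [l2, Finset.sum_add_distrib, ← Finset.mul_sum]
      nlinarith [mul_nonneg ht0 hds]
    have hlt : (Finset.univ.filter fun g => l2 g ≠ 0).card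
        < (Finset.univ.filter fun g => l g ≠ 0).card := by
      apply Finset.card_lt_card
      refine Finset.ssubset_iff_subset_ne.2 ⟨?_, ?_⟩
      · intro g hg
        simp only [Finset.mem_filter, Finset.mem_univ, true_and] at hg ⊢
        intro h
        apply hg
        simp [l2, h, hd0 g h]
      · intro heq
        have : g1 ∈ Finset.univ.filter fun g => l g ≠ 0 := by
          simp only [Finset.mem_filter, Finset.mem_univ, true_and]
          intro h
          linarith [hd0 g1 h]
        rw [← heq] at this
        simp only [Finset.mem_filter, Finset.mem_univ, true_and] at this
        apply this
        simp only [l2, ht]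
        have : d g1 ≠ 0 := hg1'.ne
        field_simp
        ring
    rw [hlc] at hlt
    exact Nat.find_min hQ hlt ⟨l2, hl2, fun l' h => (hlm l' h).trans hsum, rfl⟩
  have hli : LinearIndependent ℝ (fun g : {g // l g ≠ 0} => v g.1) := by
    rw [Fintype.linearIndependent_iff]
    intro a ha
    let d : ι → ℝ := fun g => if h : l g ≠ 0 then a ⟨g, h⟩ else 0
    have hd0 : ∀ g, l g = 0 → d g = 0 := by
      intro g hg; simp [d, hg]
    have hdv : ∀ c, ∑ g, d g * v g c = 0 := by
      intro c
      have h1 := congrFun ha c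
      simp only [Finset.sum_apply, Pi.smul_apply, smul_eq_mul, Pi.zero_apply] at h1
      have h2 : ∑ g ∈ Finset.univ.filter (fun g => l g ≠ 0), d g * v g c
          = ∑ x : {g // l g ≠ 0}, d x.1 * v x.1 c :=
        Finset.sum_subtype _ (by simp) _
      have h3 : ∑ g ∈ Finset.univ.filter (fun g => l g ≠ 0), d g * v g c
          = ∑ g, d g * v g c := by
        apply Finset.sum_subset (Finset.subset_univ _)
        intro g _ hg
        have : l g = 0 := by simpa using hg
        rw [hd0 g this, zero_mul]
      rw [← h1, ← h3, h2]
      refine Finset.sum_congr rfl fun x _ => ?_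
      have : d x.1 = a x := by simp [d, x.2]
      rw [this]
    have hdz : d = 0 := by
      rcases le_total 0 (∑ g, d g) with h | h
      · exact key d hd0 hdv h
      · have := key (-d) (by simpa using hd0) (by simpa using hdv) (by simpa using h)
        simpa using this
    intro g
    have := congrFun hdz g.1
    simpa [d, g.2] using this
  have := hli.fintype_card_le_finrank
  rw [Module.finrank_fintype_fun_eq_card, Fintype.card_subtype] at this
  exact this

theorem carath {C : Type*} [Fintype C] (P : AddSubgroup (C → ℤ)) (z : C → ℤ) (hz : z ∈ P) :
    ∃ β : (C → ℤ) →₀ ℕ, β.support.card ≤ 2 * Fintype.card C - 1 ∧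
      (∀ g ∈ β.support, g ∈ minl P ∧ conformal g z) ∧
      z = β.sum fun g k => (k : ℤ) • g := by
  classical
  let G : Finset (C → ℤ) := (minl_finite P).toFinset.filter fun g => conformal g z
  have hG : ∀ g, g ∈ G ↔ g ∈ minl P ∧ conformal g z := by intro g; simp [G]
  have hGc : ∀ g : G, conformal g.1 z := fun g => ((hG _).1 g.2).2
  have hdec : ∀ r ∈ P, conformal r z → ∃ μ : G → ℕ, ∀ c, ∑ g, (μ g : ℤ) * g.1 c = r c := by
    intro r hr hrz
    obtain ⟨μ, h1, h2⟩ := decomp P (wt r).toNat r hr (by rw [Int.toNat_of_nonneg (wt_nonneg _)])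
    refine ⟨fun g => μ g.1, fun c => ?_⟩
    have hsub : μ.support ⊆ G := fun g hg =>
      (hG g).2 ⟨(h1 g hg).1, cf_trans (h1 g hg).2 hrz⟩
    rw [Finsupp.sum_of_support_subset μ hsub _ (by simp)] at h2
    conv_rhs => rw [h2]
    rw [Finset.sum_apply, Finset.univ_eq_attach, Finset.sum_attach G (fun g => (μ g : ℤ) * g c)]
    simp
  have hsg : ∀ (g : G) (c : C), ((g.1 c : ℤ) : ℝ) * ((z c).sign : ℝ) = |(g.1 c : ℝ)| := by
    intro g c
    have := cf_sign (hGc g) c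
    rw [← Int.cast_abs, this]; push_cast; ring
  obtain ⟨l, h0, h1, hopt, hcard⟩ := lp_opt (fun (g : G) c => ((g.1 c : ℤ) : ℝ))
    (fun c => ((z c).sign : ℝ)) (fun c => (z c : ℝ)) (by
      intro g
      have h2 : (1 : ℤ) ≤ wt g.1 := wt_pos ((hG _).1 g.2).1.2.1
      have h3 : ((wt g.1 : ℤ) : ℝ) = ∑ c, ((z c).sign : ℝ) * (g.1 c : ℝ) := by
        unfold wt
        push_cast
        refine Finset.sum_congr rfl fun c _ => ?_
        rw [← hsg]; ring
      rw [← h3]; exact_mod_cast h2) (by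
      obtain ⟨μ, hμ⟩ := hdec z hz (cf_refl z)
      refine ⟨fun g => μ g, fun g => Nat.cast_nonneg _, fun c => ?_⟩
      have := hμ c
      beta_reduce
      rw [← this]
      push_cast
      rfl)
  let f : G → ℕ := fun g => ⌊l g⌋₊
  let r : C → ℤ := fun c => z c - ∑ g, (f g : ℤ) * g.1 c
  have hfl : ∀ g, (f g : ℝ) ≤ l g := fun g => Nat.floor_le (h0 g)
  have hfl' : ∀ g, l g < f g + 1 := fun g => Nat.lt_floor_add_one _
  have hrP : r ∈ P := by
    have : r = z - ∑ g : G, (f g) • g.1 := by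
      funext c; simp [r]
    rw [this]
    exact P.sub_mem hz (P.sum_mem fun g _ => P.nsmul_mem ((hG _).1 g.2).1.1 _)
  have hzs : ∀ c, (z c : ℝ) * ((z c).sign : ℝ) = |(z c : ℝ)| := by
    intro c
    have := cf_sign (cf_refl z) c
    rw [← Int.cast_abs, this]; push_cast; ring
  have hrs : ∀ c, ((r c * (z c).sign : ℤ) : ℝ) = ∑ g, (l g - f g) * |(g.1 c : ℝ)| := by
    intro c
    simp only [r]
    push_cast
    rw [← h1 c, ← Finset.sum_sub_distrib, Finset.sum_mul]
    refine Finset.sum_congr rfl fun g _ => ?_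
    rw [← hsg]; ring
  have hza : ∀ c, ((|z c| : ℤ) : ℝ) = ∑ g, l g * |(g.1 c : ℝ)| := by
    intro c
    rw [Int.cast_abs, ← hzs]
    conv_lhs => rw [← h1 c, Finset.sum_mul]
    refine Finset.sum_congr rfl fun g _ => ?_
    rw [← hsg]
    ring
  have hrz : conformal r z := by
    intro c
    apply cf_of_sign
    · have : (0 : ℝ) ≤ ((r c * (z c).sign : ℤ) : ℝ) := by
        rw [hrs]
        exact Finset.sum_nonneg fun g _ => mul_nonneg (by linarith [hfl g]) (abs_nonneg _)
      exact_mod_cast this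
    · have : ((r c * (z c).sign : ℤ) : ℝ) ≤ ((|z c| : ℤ) : ℝ) := by
        rw [hrs, hza]
        refine Finset.sum_le_sum fun g _ => mul_le_mul_of_nonneg_right ?_ (abs_nonneg _)
        have : (0 : ℝ) ≤ f g := Nat.cast_nonneg _
        linarith
      exact_mod_cast this
    · intro hc
      simp only [r]
      rw [hc, zero_sub, neg_eq_zero]
      refine Finset.sum_eq_zero fun g _ => ?_
      have := (hGc g c).1
      rw [hc] at this
      have : g.1 c = 0 := by simpa using this
      rw [this, mul_zero]
  obtain ⟨μ, hμ⟩ := hdec r hrP hrz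
  have hsum : ∀ c, ∑ g : G, ((f g + μ g : ℕ) : ℤ) * g.1 c = z c := by
    intro c
    push_cast
    simp only [add_mul, Finset.sum_add_distrib, hμ c, r]
    ring
  have hle := hopt (fun g => ((f g + μ g : ℕ) : ℝ)) (fun g => Nat.cast_nonneg _) (by
    intro c
    have := hsum c
    exact_mod_cast this)
  set T := Finset.univ.filter fun g => l g ≠ 0 with hT
  have hμT : (∑ g, (μ g : ℝ)) ≤ ∑ g ∈ T, (l g - f g) := by
    have : ∑ g ∈ T, (l g - f g) = ∑ g, (l g - f g) := by
      apply Finset.sum_subset (Finset.subset_univ _)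
      intro g _ hg
      have : l g = 0 := by simpa [hT] using hg
      simp [f, this]
    rw [this]
    push_cast at hle
    rw [Finset.sum_add_distrib] at hle
    rw [Finset.sum_sub_distrib]
    linarith
  have hμc : (Finset.univ.filter fun g => μ g ≠ 0).card ≤ ∑ g, μ g := by
    rw [Finset.card_eq_sum_ones]
    calc _ ≤ ∑ g ∈ Finset.univ.filter (fun g => μ g ≠ 0), μ g := by
          refine Finset.sum_le_sum fun g hg => ?_
          have : μ g ≠ 0 := by simpa using hg
          omega
      _ ≤ _ := Finset.sum_le_sum_of_subset (Finset.subset_univ _)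
  have hμle : ∑ g, μ g ≤ T.card - 1 := by
    rcases T.eq_empty_or_nonempty with hE | hN
    · rw [hE, Finset.sum_empty] at hμT
      have : ∑ g, μ g ≤ 0 := by exact_mod_cast hμT
      omega
    · have h2 : ∑ g ∈ T, (l g - f g) < ∑ g ∈ T, (1 : ℝ) :=
        Finset.sum_lt_sum_of_nonempty hN fun g _ => by linarith [hfl' g]
      have h3 : ((∑ g, μ g : ℕ) : ℝ) < (T.card : ℝ) := by
        push_cast
        simp only [Finset.sum_const, nsmul_eq_mul, mul_one] at h2
        exact lt_of_le_of_lt hμT h2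
      have : ∑ g, μ g < T.card := by exact_mod_cast h3
      omega
  let β : (C → ℤ) →₀ ℕ := Finsupp.onFinset G
    (fun g => if h : g ∈ G then f ⟨g, h⟩ + μ ⟨g, h⟩ else 0) (by
      intro g hg
      by_contra h
      simp [h] at hg)
  have hβ : ∀ g : G, β g.1 = f g + μ g := by intro g; simp [β]
  have hβG : β.support ⊆ G := Finsupp.support_onFinset_subset
  refine ⟨β, ?_, fun g hg => (hG g).1 (hβG hg), ?_⟩
  · have hsub : β.support ⊆ (T ∪ Finset.univ.filter fun g => μ g ≠ 0).image Subtype.val := by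
      intro g hg
      have hgG := hβG hg
      rw [Finsupp.mem_support_iff, hβ ⟨g, hgG⟩] at hg
      refine Finset.mem_image.2 ⟨⟨g, hgG⟩, ?_, rfl⟩
      simp only [hT, Finset.mem_union, Finset.mem_filter, Finset.mem_univ, true_and]
      by_contra hcon
      push Not at hcon
      apply hg
      simp [f, hcon.1, hcon.2]
    have h2 := (Finset.card_le_card hsub).trans
      (Finset.card_image_le.trans (Finset.card_union_le _ _))
    omega
  · rw [Finsupp.sum_of_support_subset β hβG _ (by simp)]
    funext c
    rw [← hsum c, Finset.sum_apply, ← Finset.sum_attach G, ← Finset.univ_eq_attach]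
    refine Finset.sum_congr rfl fun g _ => ?_
    simp [hβ]

theorem exists_exponent {M : Type*} [AddCommGroup M] [Module.Finite ℤ M] (Λ : Submodule ℤ M) :
    ∃ e : ℕ, 1 ≤ e ∧ ∀ v : M, ∀ m : ℕ, 1 ≤ m → (m : ℤ) • v ∈ Λ → (e : ℤ) • v ∈ Λ := by
  have : IsNoetherian ℤ (M ⧸ Λ) := isNoetherian_of_isNoetherianRing_of_finite ℤ _
  obtain ⟨a, ha, ha0⟩ := Submodule.annihilator_top_inter_nonZeroDivisors
    (Submodule.torsion_isTorsion (R := ℤ) (M := M ⧸ Λ))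
  have ha0 : a ≠ 0 := nonZeroDivisors.ne_zero ha0
  refine ⟨a.natAbs, by omega, fun v m hm hv => ?_⟩
  have hmem : (Submodule.Quotient.mk v : M ⧸ Λ) ∈ Submodule.torsion ℤ (M ⧸ Λ) := by
    rw [Submodule.mem_torsion_iff]
    refine ⟨⟨(m : ℤ), mem_nonZeroDivisors_of_ne_zero (by omega)⟩, ?_⟩
    change (m : ℤ) • (Submodule.Quotient.mk v : M ⧸ Λ) = 0
    rw [← Submodule.Quotient.mk_smul, Submodule.Quotient.mk_eq_zero]
    exact hv
  have h1 := Submodule.mem_annihilator.1 ha ⟨_, hmem⟩ trivial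
  have h2 : a • (Submodule.Quotient.mk v : M ⧸ Λ) = 0 := congrArg Subtype.val h1
  rw [← Submodule.Quotient.mk_smul, Submodule.Quotient.mk_eq_zero] at h2
  rcases Int.natAbs_eq a with h | h
  · rw [h] at h2; exact h2
  · rw [h, neg_smul] at h2; simpa using h2

theorem unif {τ : Type*} (T : Set τ) (hT : T.Finite) (Q : τ → ℕ → ℕ → Prop)
    (hmono : ∀ t q x q' x', Q t q x → q ≤ q' → x ≤ x' → Q t q' x')
    (h : ∀ t ∈ T, ∃ q x, Q t q x) : ∃ q x, ∀ t ∈ T, Q t q x := by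
  choose! q x hqx using h
  obtain ⟨a, ha⟩ := (hT.image q).bddAbove
  obtain ⟨b, hb⟩ := (hT.image x).bddAbove
  exact ⟨a, b, fun t ht => hmono _ _ _ _ _ (hqx t ht) (ha ⟨t, ht, rfl⟩) (hb ⟨t, ht, rfl⟩)⟩

section
variable {sA tA sD tB : ℕ}

theorem three_ker (n : ℕ) (A : Matrix (Fin sA) (Fin tA) ℤ) (B : Matrix (Fin sA) (Fin tB) ℤ)
    (D : Matrix (Fin sD) (Fin tA) ℤ) (y : (Fin tB ⊕ Fin n × Fin tA) → ℤ) :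
    (threeBlock n sA tA sD tB A B D).mulVec y = 0 ↔
      (∑ k, D.mulVec (fun j => y (Sum.inr (k, j))) = 0) ∧
      ∀ k, A.mulVec (fun j => y (Sum.inr (k, j))) + B.mulVec (fun j => y (Sum.inl j)) = 0 := by
  constructor
  · intro h
    constructor
    · funext i
      have := congrFun h (Sum.inl i)
      simpa [threeBlock, Matrix.mulVec, dotProduct, Fintype.sum_prod_type] using this
    · intro k
      funext i
      have := congrFun h (Sum.inr (k, i))
      simp [threeBlock, Matrix.mulVec, dotProduct, Fintype.sum_prod_type] at this
      simp [Matrix.mulVec, dotProduct]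
      linarith
  · rintro ⟨h1, h2⟩
    funext r
    rcases r with i | ⟨k, i⟩
    · have := congrFun h1 i
      simpa [threeBlock, Matrix.mulVec, dotProduct, Fintype.sum_prod_type] using this
    · have := congrFun (h2 k) i
      simp [Matrix.mulVec, dotProduct] at this
      simp [threeBlock, Matrix.mulVec, dotProduct, Fintype.sum_prod_type]
      linarith

theorem nfold_three (n : ℕ) (A : Matrix (Fin sA) (Fin tA) ℤ) (B : Matrix (Fin sA) (Fin tB) ℤ)
    (D : Matrix (Fin sD) (Fin tA) ℤ) (z : (Fin n × Fin tA) → ℤ) :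
    (nfold n sA tA sD D A).mulVec z =
      (threeBlock n sA tA sD tB A B D).mulVec (Sum.elim 0 z) := by
  funext r
  rcases r with i | ⟨k, i⟩ <;>
  simp [threeBlock, nfold, Matrix.mulVec, dotProduct, Fintype.sum_prod_type]

def Good (n : ℕ) (A : Matrix (Fin sA) (Fin tA) ℤ) (B : Matrix (Fin sA) (Fin tB) ℤ)
    (D : Matrix (Fin sD) (Fin tA) ℤ) (q ξ : ℕ) : Prop :=
  ∃ S : Fin q → (Fin tB ⊕ Fin n × Fin tA) → ℤ,
    (∀ h, (threeBlock n sA tA sD tB A B D).mulVec (S h) = 0 ∧ ∀ i, |S h i| ≤ (ξ : ℤ)) ∧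
    ∀ y : (Fin tB ⊕ Fin n × Fin tA) → ℤ,
      (threeBlock n sA tA sD tB A B D).mulVec y = 0 →
      ∃ α : Fin q → ℕ,
        (∀ h, ¬ (∀ j : Fin tB, |S h (Sum.inl j)| ≤ |y (Sum.inl j)| ∧
              0 ≤ S h (Sum.inl j) * y (Sum.inl j)) → α h = 0) ∧
        ∀ j, y (Sum.inl j) = ∑ h, (α h : ℤ) * S h (Sum.inl j)

theorem Good.mono {n : ℕ} {A : Matrix (Fin sA) (Fin tA) ℤ} {B : Matrix (Fin sA) (Fin tB) ℤ}
    {D : Matrix (Fin sD) (Fin tA) ℤ} {q ξ q' ξ' : ℕ} (h : Good n A B D q ξ) (hq : q ≤ q')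
    (hξ : ξ ≤ ξ') : Good n A B D q' ξ' := by
  obtain ⟨p, rfl⟩ := Nat.exists_eq_add_of_le hq
  obtain ⟨S, h1, h2⟩ := h
  refine ⟨Fin.addCases S (fun _ => 0), ?_, ?_⟩
  · intro i
    refine Fin.addCases (fun i => ?_) (fun i => ?_) i
    · simp only [Fin.addCases_left]
      exact ⟨(h1 i).1, fun c => ((h1 i).2 c).trans (by exact_mod_cast hξ)⟩
    · simp
  · intro y hy
    obtain ⟨α, h3, h4⟩ := h2 y hy
    refine ⟨Fin.addCases α (fun _ => 0), ?_, ?_⟩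
    · intro i
      refine Fin.addCases (fun i => ?_) (fun i => ?_) i
      · simp only [Fin.addCases_left]
        exact h3 i
      · simp
    · intro j
      rw [Fin.sum_univ_add]
      simp [h4 j]

def LL (A : Matrix (Fin sA) (Fin tA) ℤ) (D : Matrix (Fin sD) (Fin tA) ℤ) :
    Submodule ℤ (Fin sD → ℤ) :=
  (LinearMap.ker A.mulVecLin).map D.mulVecLin

theorem mem_LL {A : Matrix (Fin sA) (Fin tA) ℤ} {D : Matrix (Fin sD) (Fin tA) ℤ}
    {v : Fin sD → ℤ} : v ∈ LL A D ↔ ∃ k, A.mulVec k = 0 ∧ D.mulVec k = v := by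
  simp [LL, Submodule.mem_map]

def PP (A : Matrix (Fin sA) (Fin tA) ℤ) (B : Matrix (Fin sA) (Fin tB) ℤ)
    (D : Matrix (Fin sD) (Fin tA) ℤ) (e r : ℕ) : AddSubgroup (Fin tB → ℤ) where
  carrier := {b | ∃ x, A.mulVec x + B.mulVec b = 0 ∧ (r : ℤ) • D.mulVec x ∈ LL A D ∧
    (e : ℤ) • D.mulVec x ∈ LL A D}
  zero_mem' := ⟨0, by simp⟩
  add_mem' := by
    rintro b b' ⟨x, h1, h2, h3⟩ ⟨x', h1', h2', h3'⟩
    refine ⟨x + x', ?_, ?_, ?_⟩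
    · rw [Matrix.mulVec_add, Matrix.mulVec_add, add_add_add_comm, h1, h1', add_zero]
    · rw [Matrix.mulVec_add, smul_add]; exact add_mem h2 h2'
    · rw [Matrix.mulVec_add, smul_add]; exact add_mem h3 h3'
  neg_mem' := by
    rintro b ⟨x, h1, h2, h3⟩
    refine ⟨-x, ?_, ?_, ?_⟩
    · rw [Matrix.mulVec_neg, Matrix.mulVec_neg, ← neg_add, h1, neg_zero]
    · rw [Matrix.mulVec_neg, smul_neg]; exact neg_mem h2
    · rw [Matrix.mulVec_neg, smul_neg]; exact neg_mem h3

theorem ker_PP {n : ℕ} (hn : 1 ≤ n) {A : Matrix (Fin sA) (Fin tA) ℤ}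
    {B : Matrix (Fin sA) (Fin tB) ℤ}
    {D : Matrix (Fin sD) (Fin tA) ℤ} {e r m : ℕ} (hnm : n = e * m + r)
    (he : ∀ v, ∀ m : ℕ, 1 ≤ m → (m : ℤ) • v ∈ LL A D → (e : ℤ) • v ∈ LL A D)
    (y : (Fin tB ⊕ Fin n × Fin tA) → ℤ) (hy : (threeBlock n sA tA sD tB A B D).mulVec y = 0) :
    (fun j => y (Sum.inl j)) ∈ PP A B D e r := by
  rw [three_ker] at hy
  obtain ⟨h1, h2⟩ := hy
  set Y : Fin n → Fin tA → ℤ := fun k j => y (Sum.inr (k, j)) with hY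
  let z : Fin n := ⟨0, hn⟩
  have hn' : (n : ℤ) • D.mulVec (Y z) ∈ LL A D := by
    rw [mem_LL]
    refine ⟨∑ k, (Y z - Y k), ?_, ?_⟩
    · rw [Matrix.mulVec_sum]
      refine Finset.sum_eq_zero fun k _ => ?_
      rw [Matrix.mulVec_sub]
      have a := h2 z
      have b := h2 k
      rw [← b] at a
      exact sub_eq_zero.2 (add_right_cancel a)
    · rw [Matrix.mulVec_sum]
      simp only [Matrix.mulVec_sub, Finset.sum_sub_distrib]
      rw [h1]
      simp
  have he' := he _ n hn hn'
  refine ⟨Y z, h2 z, ?_, he'⟩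
  have : (r : ℤ) • D.mulVec (Y z) =
      (n : ℤ) • D.mulVec (Y z) - (m : ℤ) • (e : ℤ) • D.mulVec (Y z) := by
    rw [hnm, smul_smul, ← sub_smul]
    congr 1
    push_cast
    ring
  rw [this]
  exact sub_mem hn' (Submodule.smul_mem _ _ he')

theorem abs_le_wt {C : Type*} [Fintype C] (x : C → ℤ) (c : C) : |x c| ≤ wt x :=
  Finset.single_le_sum (f := fun c => |x c|) (fun _ _ => abs_nonneg _) (Finset.mem_univ c)

theorem good_r (A : Matrix (Fin sA) (Fin tA) ℤ) (B : Matrix (Fin sA) (Fin tB) ℤ)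
    (D : Matrix (Fin sD) (Fin tA) ℤ) (e r : ℕ) (he1 : 1 ≤ e)
    (he : ∀ v, ∀ m : ℕ, 1 ≤ m → (m : ℤ) • v ∈ LL A D → (e : ℤ) • v ∈ LL A D) :
    ∃ q ξ, ∀ n m, 1 ≤ n → n = e * m + r → Good n A B D q ξ := by
  classical
  let F := (minl_finite (PP A B D e r)).toFinset
  have hF : ∀ g, g ∈ F ↔ g ∈ minl (PP A B D e r) := by intro g; simp [F]
  let φ := F.equivFin
  have hch : ∀ h : Fin F.card, ∃ x k k' : Fin tA → ℤ,
      A.mulVec x + B.mulVec (φ.symm h).1 = 0 ∧ A.mulVec k = 0 ∧ A.mulVec k' = 0 ∧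
      D.mulVec k = (r : ℤ) • D.mulVec x ∧ D.mulVec k' = (e : ℤ) • D.mulVec x := by
    intro h
    obtain ⟨x, h1, h2, h3⟩ := ((hF _).1 (φ.symm h).2).1
    obtain ⟨k, hk, hk'⟩ := mem_LL.1 h2
    obtain ⟨l, hl, hl'⟩ := mem_LL.1 h3
    exact ⟨x, k, l, h1, hk, hl, hk', hl'⟩
  choose x k k' hx hk hk' hDk hDk' using hch
  let W : Fin F.card → ℤ := fun h => wt (φ.symm h).1 + wt (x h) + wt (k h) + wt (k' h)
  have hW0 : ∀ h, 0 ≤ W h := fun h => by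
    have := wt_nonneg (φ.symm h).1
    have := wt_nonneg (x h)
    have := wt_nonneg (k h)
    have := wt_nonneg (k' h)
    simp only [W]; linarith
  refine ⟨F.card, (∑ h, W h).toNat, fun n m hn hnm => ?_⟩
  have hWle : ∀ h, W h ≤ ((∑ h, W h).toNat : ℤ) := fun h => by
    rw [Int.toNat_of_nonneg (Finset.sum_nonneg fun h _ => hW0 h)]
    exact Finset.single_le_sum (fun h _ => hW0 h) (Finset.mem_univ h)
  let Y : Fin F.card → Fin n → Fin tA → ℤ := fun h i =>
    x h - (if i.val < m then k' h else 0) - (if i = ⟨0, hn⟩ then k h else 0)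
  refine ⟨fun h => Sum.elim (φ.symm h).1 (fun p => Y h p.1 p.2), ?_, ?_⟩
  · intro h
    constructor
    · rw [three_ker]
      simp only [Sum.elim_inr, Sum.elim_inl]
      constructor
      · change ∑ i, D.mulVec (Y h i) = 0
        rw [← Matrix.mulVec_sum]
        have hc : (Finset.univ.filter fun i : Fin n => i.val < m).card = m := by
          rw [Fin.card_filter_val_lt]
          have : m ≤ e * m := Nat.le_mul_of_pos_left m he1
          omega
        have : ∑ i, Y h i = (n : ℤ) • x h - (m : ℤ) • k' h - k h := by
          simp only [Y, Finset.sum_sub_distrib]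
          congr 1
          · congr 1
            · simp
            · rw [← Finset.sum_filter, Finset.sum_const, hc]
              simp
          · rw [Finset.sum_ite_eq' Finset.univ]; simp
        rw [this, Matrix.mulVec_sub, Matrix.mulVec_sub, Matrix.mulVec_smul, Matrix.mulVec_smul,
          hDk, hDk', smul_smul, ← sub_smul, ← sub_smul, hnm]
        convert zero_smul ℤ _
        push_cast
        ring
      · intro i
        change A.mulVec (Y h i) + B.mulVec (φ.symm h).1 = 0
        rw [← hx h]
        congr 1
        simp only [Y, Matrix.mulVec_sub]
        split_ifs <;> simp [hk, hk']
    · intro c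
      refine le_trans ?_ (hWle h)
      have e0 := wt_nonneg (φ.symm h).1
      have e1 := wt_nonneg (x h)
      have e2 := wt_nonneg (k h)
      have e3 := wt_nonneg (k' h)
      rcases c with j | ⟨i, j⟩
      · have := abs_le_wt (φ.symm h).1 j
        simp only [Sum.elim_inl, W]
        linarith
      · have a1 := abs_le_wt (x h) j
        have a2 := abs_le_wt (k h) j
        have a3 := abs_le_wt (k' h) j
        simp only [Sum.elim_inr, W, Y]
        rw [abs_le] at *
        constructor <;> split_ifs <;> simp <;> linarith
  · intro y hy
    have hP := ker_PP hn hnm he y hy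
    obtain ⟨μ, h1, h2⟩ := decomp _ (wt (fun j => y (Sum.inl j))).toNat _ hP
      (by rw [Int.toNat_of_nonneg (wt_nonneg _)])
    have hsub : μ.support ⊆ F := fun g hg => (hF g).2 (h1 g hg).1
    refine ⟨fun h => μ (φ.symm h).1, ?_, ?_⟩
    · intro h hh
      by_contra hne
      exact hh ((h1 _ (Finsupp.mem_support_iff.2 hne)).2)
    · intro j
      rw [Finsupp.sum_of_support_subset μ hsub _ (by simp)] at h2
      have h3 := congrFun h2 j
      simp only [Finset.sum_apply] at h3
      rw [h3, ← Finset.sum_attach F, ← Finset.univ_eq_attach]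
      rw [← Equiv.sum_comp φ.symm]
      simp

theorem good_all (A : Matrix (Fin sA) (Fin tA) ℤ) (B : Matrix (Fin sA) (Fin tB) ℤ)
    (D : Matrix (Fin sD) (Fin tA) ℤ) : ∃ q ξ, ∀ n, 1 ≤ n → Good n A B D q ξ := by
  obtain ⟨e, he1, he⟩ := exists_exponent (LL A D)
  obtain ⟨q, ξ, h⟩ := unif (Set.Iio e) (Set.finite_Iio e)
    (fun r q ξ => ∀ n m, 1 ≤ n → n = e * m + r → Good n A B D q ξ)
    (fun r q x q' x' h hq hx n m hn hnm => (h n m hn hnm).mono hq hx)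
    (fun r _ => good_r A B D e r he1 he)
  exact ⟨q, ξ, fun n hn => h (n % e) (Nat.mod_lt _ he1) n (n / e) hn (Nat.div_add_mod n e).symm⟩

theorem good_unif (sA tA sD tB Δ : ℕ) : ∃ q ξ, ∀ (A : Matrix (Fin sA) (Fin tA) ℤ)
    (B : Matrix (Fin sA) (Fin tB) ℤ) (D : Matrix (Fin sD) (Fin tA) ℤ),
      (∀ i j, |A i j| ≤ (Δ : ℤ)) → (∀ i j, |B i j| ≤ (Δ : ℤ)) →
      (∀ i j, |D i j| ≤ (Δ : ℤ)) → ∀ n, 1 ≤ n → Good n A B D q ξ := by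
  have hfin : ∀ s t : ℕ, (Set.Icc (fun (_ : Fin s) (_ : Fin t) => -(Δ : ℤ))
    (fun _ _ => (Δ : ℤ))).Finite := fun s t => Set.finite_Icc _ _
  obtain ⟨q, ξ, h⟩ := unif _ ((hfin sA tA).prod ((hfin sA tB).prod (hfin sD tA)))
    (fun t q ξ => ∀ n, 1 ≤ n → Good n (Matrix.of t.1) (Matrix.of t.2.1) (Matrix.of t.2.2) q ξ)
    (fun r q x q' x' h hq hx n hn => (h n hn).mono hq hx)
    (fun t _ => good_all _ _ _)
  refine ⟨q, ξ, fun A B D hA hB hD n hn => ?_⟩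
  refine h (A, B, D) ⟨?_, ?_, ?_⟩ n hn
  · exact ⟨fun i j => (abs_le.1 (hA i j)).1, fun i j => (abs_le.1 (hA i j)).2⟩
  · exact ⟨fun i j => (abs_le.1 (hB i j)).1, fun i j => (abs_le.1 (hB i j)).2⟩
  · exact ⟨fun i j => (abs_le.1 (hD i j)).1, fun i j => (abs_le.1 (hD i j)).2⟩
end

/-- There is a fixed set `S` of `q'` bounded kernel elements of the 3-block n-fold matrix
such that any kernel element `y` decomposes as a conic combination of elements of `S`
(using only those whose 0-th brick is `⊑ y^0`) plus a conic combination of at most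
`2·n·t_A − 1` pairwise sign-compatible vectors `(0, g_ℓ(E))` with `g_ℓ(E) ∈ G(E)`. -/
theorem compact_decomposition_threeBlock
    (sA tA sD tB Δ : ℕ) (hsA : 0 < sA) (htA : 0 < tA) (hsD : 0 < sD)
    (htB : 0 < tB) (hΔ : 0 < Δ) :
    ∃ q' ξ : ℕ, ∀ n : ℕ, 1 ≤ n →
      ∀ (A : Matrix (Fin sA) (Fin tA) ℤ) (B : Matrix (Fin sA) (Fin tB) ℤ)
        (D : Matrix (Fin sD) (Fin tA) ℤ),
      (∀ i j, |A i j| ≤ (Δ : ℤ)) → (∀ i j, |B i j| ≤ (Δ : ℤ)) →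
      (∀ i j, |D i j| ≤ (Δ : ℤ)) →
      ∃ S : Fin q' → (Fin tB ⊕ Fin n × Fin tA) → ℤ,
        (∀ h, (threeBlock n sA tA sD tB A B D).mulVec (S h) = 0 ∧
          ∀ i, |S h i| ≤ (ξ : ℤ)) ∧
        ∀ y : (Fin tB ⊕ Fin n × Fin tA) → ℤ,
          (threeBlock n sA tA sD tB A B D).mulVec y = 0 →
          ∃ (α : Fin q' → ℕ) (L : ℕ) (β : Fin L → ℕ)
            (gE : Fin L → (Fin n × Fin tA) → ℤ),
            L ≤ 2 * n * tA - 1 ∧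
            (∀ ℓ, gE ℓ ∈ graverBasis (nfold n sA tA sD D A)) ∧
            (∀ h, ¬ (∀ j : Fin tB, |S h (Sum.inl j)| ≤ |y (Sum.inl j)| ∧
              0 ≤ S h (Sum.inl j) * y (Sum.inl j)) → α h = 0) ∧
            (∀ ℓ ℓ' : Fin L, ∀ p : Fin n × Fin tA, 0 ≤ gE ℓ p * gE ℓ' p) ∧
            y = (∑ h, (α h : ℤ) • S h) +
              ∑ ℓ, (β ℓ : ℤ) • (Sum.elim (0 : Fin tB → ℤ) (gE ℓ)) := by
  obtain ⟨q, ξ, hg⟩ := good_unif sA tA sD tB Δ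
  refine ⟨q, ξ, fun n hn A B D hA hB hD => ?_⟩
  obtain ⟨S, h1, h2⟩ := hg A B D hA hB hD n hn
  refine ⟨S, h1, fun y hy => ?_⟩
  obtain ⟨α, h3, h4⟩ := h2 y hy
  set u : (Fin tB ⊕ Fin n × Fin tA) → ℤ := y - ∑ h, (α h : ℤ) • S h with hu
  let z : (Fin n × Fin tA) → ℤ := fun p => u (Sum.inr p)
  have huz : u = Sum.elim (0 : Fin tB → ℤ) z := by
    funext c
    rcases c with j | p
    · simp [hu, h4 j]
    · simp [z]
  let P : AddSubgroup ((Fin n × Fin tA) → ℤ) :=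
    (LinearMap.ker (nfold n sA tA sD D A).mulVecLin).toAddSubgroup
  have hP : ∀ w, w ∈ P ↔ (nfold n sA tA sD D A).mulVec w = 0 := by
    intro w; simp [P]
  have hz : z ∈ P := by
    rw [hP, nfold_three n A B D, ← huz, hu, Matrix.mulVec_sub, hy, Matrix.mulVec_sum]
    rw [zero_sub, neg_eq_zero]
    refine Finset.sum_eq_zero fun h _ => ?_
    rw [Matrix.mulVec_smul, (h1 h).1, smul_zero]
  obtain ⟨β, hc, hβ, hs⟩ := carath P z hz
  let φ := β.support.equivFin
  refine ⟨α, β.support.card, fun l => β (φ.symm l).1, fun l => (φ.symm l).1, ?_, ?_, h3, ?_, ?_⟩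
  · simpa [mul_assoc] using hc
  · intro l
    obtain ⟨a, b, c⟩ := (hβ _ (φ.symm l).2).1
    exact ⟨(hP _).1 a, b, fun w hw => c w ((hP _).2 hw)⟩
  · intro l l' p
    have a := (hβ _ (φ.symm l).2).2
    have b := (hβ _ (φ.symm l').2).2
    have a1 := cf_sign a p
    have b1 := cf_sign b p
    rcases lt_trichotomy (z p) 0 with hzp | hzp | hzp
    · rw [Int.sign_eq_neg_one_of_neg hzp] at a1 b1
      have := abs_nonneg ((φ.symm l).1 p)
      have := abs_nonneg ((φ.symm l').1 p)
      nlinarith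
    · rw [hzp] at a1
      have : (φ.symm l).1 p = 0 := by simpa using a1
      simp [this]
    · rw [Int.sign_eq_one_of_pos hzp] at a1 b1
      have := abs_nonneg ((φ.symm l).1 p)
      have := abs_nonneg ((φ.symm l').1 p)
      nlinarith
  · have h5 : ∑ l, (β (φ.symm l).1 : ℤ) • (Sum.elim (0 : Fin tB → ℤ) (φ.symm l).1) = u := by
      rw [Equiv.sum_comp φ.symm (fun g => (β g.1 : ℤ) • (Sum.elim (0 : Fin tB → ℤ) g.1)), huz]
      rw [Finset.univ_eq_attach, Finset.sum_attach β.support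
        (fun g => (β g : ℤ) • (Sum.elim (0 : Fin tB → ℤ) g))]
      funext c
      rcases c with j | p
      · simp [Finset.sum_apply]
      · have := congrFun hs p
        simp only [Finsupp.sum, Finset.sum_apply] at this
        simp [Finset.sum_apply, this]
    rw [h5, hu]
    abel
end
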